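/- arXiv:2504.19743 — 4 statements merged into one kernel-verified Lean document; each statement's English description precedes it below -/
import Mathlib

section
/- Let μ be a positive finite Borel measure on (0,1), let 1 ≤ p < ∞, and let α, β > -1 with β - α > -1. Let ρ, η ∈ (0, 1/2). Then there exists a natural number N₀ = N₀(ρ, η), independent of ε, such that for every ε ∈ (0, (β+1)/p) and every n ≥ N₀, one has w₂(n)^{1/p} A_n ≥ (1-ρ)² · w₁(n)^{1/p} · a_n · ∫_η^{1-η} (1-t)^{-(1-1/p)(β+1)+ε} t^{-(β+1)/p - ε} dμ(t), where a_m = (m+1)_α (m+1)_β^{-1/p} (m+β+1)^{-(1/p+ε)} and A_n = ∑_{m=0}^∞ ∫_{(0,1)} k_{α,β}(m,n) t^m (1-t)^n |a_m| dμ(t). -/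
open MeasureTheory Set ENNReal

/-- `(γ+1)_s = Γ(γ+s+1)/Γ(γ+1)`. -/
noncomputable def poch (γ s : ℝ) : ℝ := Real.Gamma (γ + s + 1) / Real.Gamma (γ + 1)

/-- `k_{α,β}(m,n) = Γ(n+m+β+1)/(Γ(m+α+1)Γ(n+β-α+1))`. -/
noncomputable def kker (α β : ℝ) (m n : ℕ) : ℝ :=
  Real.Gamma ((n : ℝ) + (m : ℝ) + β + 1) /
    (Real.Gamma ((m : ℝ) + α + 1) * Real.Gamma ((n : ℝ) + β - α + 1))

/-- The weight `w₁(m) = (m+1)_α^{-p} (m+1)_β`. -/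
noncomputable def w1 (α β p : ℝ) (m : ℕ) : ℝ := (poch (m : ℝ) α) ^ (-p) * poch (m : ℝ) β

/-- The weight `w₂(m) = (m+β-α+1)_α^{-p} (m+1)_β`. -/
noncomputable def w2 (α β p : ℝ) (m : ℕ) : ℝ :=
  (poch ((m : ℝ) + β - α) α) ^ (-p) * poch (m : ℝ) β

/-- The test sequence `a_m = (m+1)_α (m+1)_β^{-1/p} (m+β+1)^{-(1/p+ε)}`. -/
noncomputable def aseq (α β p ε : ℝ) (m : ℕ) : ℝ :=
  poch (m : ℝ) α * (poch (m : ℝ) β) ^ (-(1 / p)) * ((m : ℝ) + β + 1) ^ (-(1 / p) - ε)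

/-- `A_n = ∑_m ∫_{(0,1)} k_{α,β}(m,n) t^m (1-t)^n |a_m| dμ(t)`. -/
noncomputable def Aseq (μ : Measure ℝ) (α β p ε : ℝ) (n : ℕ) : ℝ≥0∞ :=
  ∑' m : ℕ, ∫⁻ t in Ioo (0 : ℝ) 1,
    ENNReal.ofReal (kker α β m n * t ^ m * (1 - t) ^ n * |aseq α β p ε m|) ∂μ

open Filter Topology in
/-- Bernoulli inequality for negative exponents, in tangent form. -/
lemma aux_tangent {q x y : ℝ} (hq : 0 ≤ q) (hx : 0 < x) (hy : 0 < y) :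
    y ^ (-q) * (1 + q - q * (x / y)) ≤ x ^ (-q) := by
  have hxy : 0 < x / y := div_pos hx hy
  have h1 : 1 + q - q * (x / y) ≤ (x / y) ^ (-q) := by
    rw [Real.rpow_def_of_pos hxy]
    have h2 := Real.add_one_le_exp (Real.log (x / y) * -q)
    have h3 := Real.log_le_sub_one_of_pos hxy
    nlinarith
  calc y ^ (-q) * (1 + q - q * (x / y)) ≤ y ^ (-q) * (x / y) ^ (-q) := by gcongr
    _ = x ^ (-q) := by
      rw [← Real.mul_rpow hy.le hxy.le]
      congr 1
      field_simp

lemma aux_gamma_ratio {x s : ℝ} (hx : 0 < x) (hs : 0 < s) :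
    Real.Gamma (x + s) / Real.Gamma x ≤ (x + s) ^ s := by
  have h := Real.convexOn_log_Gamma.slope_mono_adjacent (x := x) (y := x + s) (z := x + s + 1)
    (by simpa using hx) (by simp only [mem_Ioi]; linarith) (by linarith) (by linarith)
  have g1 := Real.Gamma_pos_of_pos hx
  have g2 := Real.Gamma_pos_of_pos (show 0 < x + s by linarith)
  have e : Real.Gamma (x + s + 1) = (x + s) * Real.Gamma (x + s) :=
    Real.Gamma_add_one (by linarith)
  simp only [Function.comp, e] at h
  rw [Real.log_mul (by linarith) g2.ne', ← Real.log_div g2.ne' g1.ne'] at h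
  rw [show x + s - x = s by ring, show x + s + 1 - (x + s) = 1 by ring, div_one,
    add_sub_cancel_right, div_le_iff₀ hs] at h
  rw [← Real.log_le_log_iff (by positivity) (by positivity), Real.log_rpow (by linarith)]
  linarith

/-- negative binomial coefficient -/
noncomputable def nbc (r : ℝ) (m : ℕ) : ℝ :=
  Real.Gamma (r + m) / (Real.Gamma r * (m.factorial : ℝ))

lemma nbc_succ {r : ℝ} (hr : 0 < r) (m : ℕ) :
    ((m + 1 : ℕ) : ℝ) * nbc r (m + 1) = r * nbc (r + 1) m := by
  unfold nbc
  have g1 := Real.Gamma_pos_of_pos hr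
  rw [Real.Gamma_add_one hr.ne', Nat.factorial_succ]
  push_cast
  rw [show r + ((m : ℝ) + 1) = r + 1 + m by ring]
  have : ((m.factorial : ℕ) : ℝ) ≠ 0 := by positivity
  field_simp

lemma gamma_add_nat {r : ℝ} (hr : 0 < r) (m : ℕ) :
    Real.Gamma (r + m) = (ascPochhammer ℝ m).eval r * Real.Gamma r := by
  induction m with
  | zero => simp
  | succ k ih =>
    push_cast
    rw [← add_assoc, Real.Gamma_add_one (by positivity), ih, ascPochhammer_succ_eval]
    ring

lemma nbc_eq_choose {r : ℝ} (hr : 0 < r) (m : ℕ) : nbc r m = Ring.choose (r + m - 1) m := by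
  rw [← Ring.multichoose_eq]
  have h := Ring.factorial_nsmul_multichoose_eq_ascPochhammer r m
  rw [Polynomial.ascPochhammer_smeval_eq_eval] at h
  have g1 := Real.Gamma_pos_of_pos hr
  unfold nbc
  rw [gamma_add_nat hr, ← h, nsmul_eq_mul]
  have : ((m.factorial : ℕ) : ℝ) ≠ 0 := by positivity
  field_simp

lemma aux_hasSum_congr {f g : ℕ → ℝ} {a : ℝ} (h : ∀ m, f m = g m) (hg : HasSum g a) :
    HasSum f a := by
  rwa [funext h]

lemma nbc_hasSum {r t : ℝ} (hr : 0 < r) (h0 : 0 < t) (h1 : t < 1) :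
    HasSum (fun m : ℕ => nbc r m * t ^ m) ((1 - t) ^ (-r)) := by
  have h := (Real.one_div_one_sub_rpow_hasFPowerSeriesOnBall_zero r).hasSum (y := t) (by
    simp only [Metric.mem_eball, edist_zero_right]
    rw [← ofReal_norm, Real.norm_of_nonneg h0.le]
    simpa using h1)
  rw [zero_add, one_div, ← Real.rpow_neg (by linarith)] at h
  refine aux_hasSum_congr (fun m => ?_) h
  rw [FormalMultilinearSeries.ofScalars_apply_eq, nbc_eq_choose hr]
  simp

lemma nbc_mean {r t : ℝ} (hr : 0 < r) (h0 : 0 < t) (h1 : t < 1) :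
    HasSum (fun m : ℕ => (m : ℝ) * (nbc r m * t ^ m)) (r * t * (1 - t) ^ (-(r + 1))) := by
  rw [← hasSum_nat_add_iff' 1]
  simp only [Finset.range_one, Finset.sum_singleton, Nat.cast_zero, zero_mul, sub_zero]
  have h := (nbc_hasSum (show 0 < r + 1 by linarith) h0 h1).mul_left (r * t)
  refine aux_hasSum_congr (fun m => ?_) h
  rw [← mul_assoc, nbc_succ hr]
  ring

lemma aux_ofReal_tsum {f h : ℕ → ℝ} {x : ℝ} (hs : HasSum h x) (hle : ∀ m, h m ≤ f m) :
    ENNReal.ofReal x ≤ ∑' m, ENNReal.ofReal (f m) := by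
  have ht : Filter.Tendsto (fun s : Finset ℕ => ENNReal.ofReal (∑ m ∈ s, h m)) Filter.atTop
      (nhds (ENNReal.ofReal x)) := (ENNReal.continuous_ofReal.tendsto x).comp hs
  refine le_of_tendsto ht (Filter.Eventually.of_forall fun s => ?_)
  calc ENNReal.ofReal (∑ m ∈ s, h m) ≤ ENNReal.ofReal (∑ m ∈ s, max (f m) 0) := by
        gcongr with m; exact (hle m).trans (le_max_left _ _)
    _ = ∑ m ∈ s, ENNReal.ofReal (f m) := by
        rw [ENNReal.ofReal_sum_of_nonneg (fun _ _ => le_max_right _ _)]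
        simp
    _ ≤ _ := ENNReal.sum_le_tsum s

lemma poch_pos {γ s : ℝ} (h1 : 0 < γ + s + 1) (h2 : 0 < γ + 1) : 0 < poch γ s :=
  div_pos (Real.Gamma_pos_of_pos h1) (Real.Gamma_pos_of_pos h2)

lemma poch_succ {β : ℝ} (hβ : -1 < β) (n : ℕ) :
    poch n β * ((n : ℝ) + β + 1) = poch n (β + 1) := by
  unfold poch
  rw [show (n : ℝ) + (β + 1) + 1 = (n + β + 1) + 1 by ring,
    Real.Gamma_add_one (s := (n : ℝ) + β + 1) (by have : (0:ℝ) ≤ n := by positivity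
                                                  linarith)]
  ring

lemma g_lower {β p ε : ℝ} (hp : 1 ≤ p) (hβ : -1 < β) (hε : 0 < ε) (m : ℕ) :
    ((m : ℝ) + β + 2) ^ (-((β + 1) / p + ε)) ≤
      (poch (m : ℝ) β) ^ (-(1 / p)) * ((m : ℝ) + β + 1) ^ (-(1 / p) - ε) := by
  have hm : (0 : ℝ) ≤ m := by positivity
  have hx : 0 < (m : ℝ) + β + 1 := by linarith
  have hP : 0 < poch (m : ℝ) β := poch_pos hx (by linarith)
  have e1 : (poch (m : ℝ) β) ^ (-(1 / p)) * ((m : ℝ) + β + 1) ^ (-(1 / p) - ε)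
      = (poch (m : ℝ) (β + 1)) ^ (-(1 / p)) * ((m : ℝ) + β + 1) ^ (-ε) := by
    rw [← poch_succ hβ, Real.mul_rpow hP.le hx.le, mul_assoc, ← Real.rpow_add hx,
      sub_eq_add_neg]
  have hb : poch (m : ℝ) (β + 1) ≤ ((m : ℝ) + β + 2) ^ (β + 1) := by
    have := aux_gamma_ratio (x := (m : ℝ) + 1) (s := β + 1) (by linarith) (by linarith)
    unfold poch
    convert this using 2 <;> ring_nf
  have hpos : 0 < poch (m : ℝ) (β + 1) := by rw [← poch_succ hβ]; positivity
  have hp0 : 0 < p := by linarith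
  rw [e1, neg_add, Real.rpow_add (by linarith)]
  have hy : 0 < (m : ℝ) + β + 2 := by linarith
  have h1 : ((m : ℝ) + β + 2) ^ (-((β + 1) / p)) ≤ (poch (m : ℝ) (β + 1)) ^ (-(1 / p)) := by
    calc ((m : ℝ) + β + 2) ^ (-((β + 1) / p))
        = (((m : ℝ) + β + 2) ^ (β + 1)) ^ (-(1 / p)) := by
          rw [← Real.rpow_mul hy.le]; congr 1; ring
      _ ≤ _ := Real.rpow_le_rpow_of_nonpos hpos hb (by simp; positivity)
  have h2 : ((m : ℝ) + β + 2) ^ (-ε) ≤ ((m : ℝ) + β + 1) ^ (-ε) :=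
    Real.rpow_le_rpow_of_nonpos hx (by linarith) (by linarith)
  gcongr

open Filter Topology in
lemma tendsto_r {c d : ℝ} : Tendsto (fun n : ℕ => ((n : ℝ) + c) / ((n : ℝ) + d)) atTop (𝓝 1) := by
  have h : Tendsto (fun n : ℕ => 1 + (c - d) / ((n : ℝ) + d)) atTop (𝓝 (1 + 0)) := by
    refine tendsto_const_nhds.add (Tendsto.const_div_atTop ?_ _)
    exact tendsto_atTop_add_const_right _ _ tendsto_natCast_atTop_atTop
  rw [add_zero] at h
  refine h.congr' ?_
  have : ∀ᶠ n : ℕ in atTop, -d < (n : ℝ) :=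
    tendsto_natCast_atTop_atTop.eventually (eventually_gt_atTop (-d))
  filter_upwards [this] with n hn
  have : (n : ℝ) + d ≠ 0 := by linarith
  field_simp
  ring

open Filter Topology in
lemma tendsto_poch {β : ℝ} (hβ : -1 < β) :
    Tendsto (fun n : ℕ => poch n β / ((n : ℝ) + β + 1) ^ β) atTop (𝓝 1) := by
  have hs : 0 < β + 1 := by linarith
  have hG := Real.Gamma_pos_of_pos hs
  have h1 := (tendsto_const_nhds (x := Real.Gamma (β + 1))).div (Real.GammaSeq_tendsto_Gamma (β + 1)) hG.ne'
  rw [div_self hG.ne'] at h1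
  have h2 : Tendsto (fun n : ℕ => (((n : ℝ) + 0) / ((n : ℝ) + (β + 1))) ^ (β + 1)) atTop (𝓝 1) := by
    simpa using (tendsto_r (c := 0) (d := β + 1)).rpow_const (p := β + 1) (Or.inl one_ne_zero)
  have h3 := h1.mul h2
  rw [mul_one] at h3
  refine h3.congr' ?_
  filter_upwards [eventually_gt_atTop 0] with n hn
  have hn0 : (0 : ℝ) < n := by exact_mod_cast hn
  have hr : 0 < (n : ℝ) + (β + 1) := by linarith
  have e := gamma_add_nat hs (n + 1)
  have e2 : (ascPochhammer ℝ (n + 1)).eval (β + 1) = ∏ j ∈ Finset.range (n + 1), (β + 1 + j) := by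
    have hk : ∀ k : ℕ, (ascPochhammer ℝ k).eval (β + 1) = ∏ j ∈ Finset.range k, (β + 1 + j) := by
      intro k
      induction k with
      | zero => simp
      | succ k ih => rw [ascPochhammer_succ_eval, ih, Finset.prod_range_succ]
    exact hk (n + 1)
  simp only [Pi.div_apply, Real.GammaSeq]
  rw [← e2, Real.div_rpow (by linarith) hr.le, add_zero]
  have e3 : poch n β / ((n : ℝ) + β + 1) ^ β = poch n (β + 1) / ((n : ℝ) + (β + 1)) ^ (β + 1) := by
    rw [← poch_succ hβ, Real.rpow_add_one hr.ne', ← add_assoc]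
    have hr' : 0 < (n : ℝ) + β + 1 := by linarith
    field_simp
  rw [e3, poch, show (n : ℝ) + (β + 1) + 1 = β + 1 + ((n + 1 : ℕ) : ℝ) by push_cast; ring, e,
    Real.Gamma_nat_eq_factorial]
  have := Real.rpow_pos_of_pos hn0 (β + 1)
  have := Real.rpow_pos_of_pos hr (β + 1)
  have : (0:ℝ) < n.factorial := by positivity
  field_simp

lemma term_eq {p α β ε t : ℝ} (hp : 1 ≤ p) (hα : -1 < α) (hβ : -1 < β) (hβα : -1 < β - α)
    (n m : ℕ) :
    (w2 α β p n) ^ (1 / p) * (kker α β m n * t ^ m * (1 - t) ^ n * |aseq α β p ε m|) =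
      (poch n β) ^ (1 / p) * (1 - t) ^ n * (nbc ((n : ℝ) + β + 1) m * t ^ m) *
        ((poch (m : ℝ) β) ^ (-(1 / p)) * ((m : ℝ) + β + 1) ^ (-(1 / p) - ε)) := by
  have hp0 : 0 < p := by linarith
  have hm : (0 : ℝ) ≤ m := by positivity
  have hn : (0 : ℝ) ≤ n := by positivity
  have hPm : 0 < poch (m : ℝ) β := poch_pos (by linarith) (by linarith)
  have hPn : 0 < poch (n : ℝ) β := poch_pos (by linarith) (by linarith)
  have hPa : 0 < poch (m : ℝ) α := poch_pos (by linarith) (by linarith)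
  have hQ : 0 < poch ((n : ℝ) + β - α) α := poch_pos (by linarith) (by linarith)
  have hx : 0 < (m : ℝ) + β + 1 := by linarith
  have ha : |aseq α β p ε m| = aseq α β p ε m := by
    apply abs_of_nonneg
    unfold aseq
    positivity
  have hw : (w2 α β p n) ^ (1 / p) = (poch ((n : ℝ) + β - α) α)⁻¹ * (poch n β) ^ (1 / p) := by
    unfold w2
    rw [Real.mul_rpow (by positivity) hPn.le, ← Real.rpow_mul hQ.le,
      show -p * (1 / p) = -1 by field_simp, Real.rpow_neg_one]
  rw [ha, hw]
  unfold aseq kker nbc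
  generalize (poch (m : ℝ) β) ^ (-(1 / p)) = A
  generalize ((m : ℝ) + β + 1) ^ (-(1 / p) - ε) = B
  generalize (poch (n : ℝ) β) ^ (1 / p) = C
  unfold poch
  rw [Real.Gamma_nat_eq_factorial, show (n : ℝ) + β - α + α + 1 = n + β + 1 by ring,
    show (n : ℝ) + β + 1 + m = n + m + β + 1 by ring]
  have g1 := Real.Gamma_pos_of_pos (show 0 < (n : ℝ) + β - α + 1 by linarith)
  have g2 := Real.Gamma_pos_of_pos (show 0 < (n : ℝ) + β + 1 by linarith)
  have g3 := Real.Gamma_pos_of_pos (show 0 < (m : ℝ) + α + 1 by linarith)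
  have : (0:ℝ) < m.factorial := by positivity
  field_simp

lemma core_sum {p α β ε t : ℝ} (hp : 1 ≤ p) (hα : -1 < α) (hβ : -1 < β) (hβα : -1 < β - α)
    (hε : 0 < ε) (h0 : 0 < t) (h1 : t < 1) (n : ℕ) :
    ENNReal.ofReal ((poch n β) ^ (1 / p) * (1 - t) ^ (-(β + 1)) *
      (((n : ℝ) + β + 1) * t / (1 - t) + (β + 2)) ^ (-((β + 1) / p + ε))) ≤
    ∑' m : ℕ, ENNReal.ofReal ((w2 α β p n) ^ (1 / p) *
      (kker α β m n * t ^ m * (1 - t) ^ n * |aseq α β p ε m|)) := by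
  have hp0 : 0 < p := by linarith
  have hn : (0 : ℝ) ≤ n := by positivity
  have hr : 0 < (n : ℝ) + β + 1 := by linarith
  have ht : 0 < 1 - t := by linarith
  have hPn : 0 < poch (n : ℝ) β := poch_pos (by linarith) (by linarith)
  set r := (n : ℝ) + β + 1 with hrdef
  set q := (β + 1) / p + ε with hq
  have hb1 : 0 < β + 1 := by linarith
  have hb2 : 0 < β + 2 := by linarith
  have hq0 : 0 < q := by positivity
  set X := r * t / (1 - t) + (β + 2) with hX
  have hX0 : 0 < X := by positivity
  set D := (poch (n : ℝ) β) ^ (1 / p) * (1 - t) ^ n with hD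
  have hD0 : 0 < D := by positivity
  have hs := (((nbc_hasSum hr h0 h1).mul_left (D * X ^ (-q) * (1 + q - q * (β + 2) / X))).sub
    ((nbc_mean hr h0 h1).mul_left (D * X ^ (-q) * (q / X))))
  have hval : D * X ^ (-q) * (1 + q - q * (β + 2) / X) * (1 - t) ^ (-r) -
      D * X ^ (-q) * (q / X) * (r * t * (1 - t) ^ (-(r + 1))) =
      (poch (n : ℝ) β) ^ (1 / p) * (1 - t) ^ (-(β + 1)) * X ^ (-q) := by
    have e1 : (1 - t) ^ (-(r + 1)) = (1 - t) ^ (-r) / (1 - t) := by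
      rw [← Real.rpow_sub_one ht.ne']; congr 1; ring
    have e2 : (1 - t) ^ n * (1 - t) ^ (-r) = (1 - t) ^ (-(β + 1)) := by
      rw [← Real.rpow_natCast, ← Real.rpow_add ht]; congr 1; rw [hrdef]; ring
    have e3 : (1 + q - q * (β + 2) / X) - q / X * (r * t / (1 - t)) = 1 := by
      have : r * t / (1 - t) = X - (β + 2) := by rw [hX]; ring
      rw [this]; field_simp; ring
    rw [e1, ← e2, hD]
    linear_combination ((poch (n : ℝ) β) ^ (1 / p) * (1 - t) ^ n * X ^ (-q) * (1 - t) ^ (-r)) * e3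
  rw [hval] at hs
  refine aux_ofReal_tsum hs fun m => ?_
  rw [term_eq hp hα hβ hβα]
  have hm : (0 : ℝ) ≤ m := by positivity
  have hc : 0 ≤ nbc r m * t ^ m := by
    have g1 := Real.Gamma_pos_of_pos hr
    have g2 := Real.Gamma_pos_of_pos (show 0 < r + m by positivity)
    unfold nbc
    positivity
  have k1 := g_lower hp hβ hε m
  have k2 := aux_tangent (q := q) (x := (m : ℝ) + β + 2) (y := X) hq0.le (by linarith) hX0
  calc _ = D * (nbc r m * t ^ m) * (X ^ (-q) * (1 + q - q * (((m : ℝ) + β + 2) / X))) := by ring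
    _ ≤ _ := mul_le_mul_of_nonneg_left (k2.trans k1) (by positivity)

open Filter Topology in
lemma exists_N {p β ρ K : ℝ} (hβ : -1 < β) (hρ : 0 < ρ) :
    ∃ N : ℕ, ∀ n : ℕ, N ≤ n →
      1 - ρ ≤ (poch n β / ((n : ℝ) + β + 1) ^ β) ^ (1 / p) ∧
      1 - ρ ≤ (((n : ℝ) + (β + 1)) / ((n : ℝ) + (β + 1 + K))) ^ (2 * ((β + 1) / p)) := by
  have h1 : Tendsto (fun n : ℕ => (poch n β / ((n : ℝ) + β + 1) ^ β) ^ (1 / p)) atTop (𝓝 1) := by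
    simpa using (tendsto_poch hβ).rpow_const (p := 1 / p) (Or.inl one_ne_zero)
  have h2 : Tendsto (fun n : ℕ => (((n : ℝ) + (β + 1)) / ((n : ℝ) + (β + 1 + K))) ^
      (2 * ((β + 1) / p))) atTop (𝓝 1) := by
    simpa using (tendsto_r (c := β + 1) (d := β + 1 + K)).rpow_const (p := 2 * ((β + 1) / p))
      (Or.inl one_ne_zero)
  have := (h1.eventually_const_le (show 1 - ρ < 1 by linarith)).and
    (h2.eventually_const_le (show 1 - ρ < 1 by linarith))
  exact eventually_atTop.mp this

lemma real_bound {p α β ρ η ε t : ℝ} {n : ℕ} (hp : 1 ≤ p) (hα : -1 < α) (hβ : -1 < β)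
    (hρ : ρ < 1) (hη : 0 < η) (hε : 0 < ε) (hε2 : ε < (β + 1) / p)
    (ht0 : η ≤ t) (ht1 : t < 1)
    (c1 : 1 - ρ ≤ (poch n β / ((n : ℝ) + β + 1) ^ β) ^ (1 / p))
    (c2 : 1 - ρ ≤ (((n : ℝ) + (β + 1)) / ((n : ℝ) + (β + 1 + (β + 2) / η))) ^
      (2 * ((β + 1) / p))) :
    ((1 - ρ) ^ 2 * (w1 α β p n) ^ (1 / p) * aseq α β p ε n) *
      ((1 - t) ^ (-(1 - 1 / p) * (β + 1) + ε) * t ^ (-((β + 1) / p) - ε)) ≤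
    (poch n β) ^ (1 / p) * (1 - t) ^ (-(β + 1)) *
      (((n : ℝ) + β + 1) * t / (1 - t) + (β + 2)) ^ (-((β + 1) / p + ε)) := by
  have hp0 : 0 < p := by linarith
  have hn : (0 : ℝ) ≤ n := by positivity
  have hr : 0 < (n : ℝ) + β + 1 := by linarith
  have ht : 0 < 1 - t := by linarith
  have ht' : 0 < t := by linarith
  have hPn : 0 < poch (n : ℝ) β := poch_pos (by linarith) (by linarith)
  have hPa : 0 < poch (n : ℝ) α := poch_pos (by linarith) (by linarith)
  have hb1 : 0 < β + 1 := by linarith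
  have hb2 : 0 < β + 2 := by linarith
  have hw : (w1 α β p n) ^ (1 / p) * aseq α β p ε n = ((n : ℝ) + β + 1) ^ (-(1 / p) - ε) := by
    unfold w1 aseq
    rw [Real.mul_rpow (by positivity) hPn.le, ← Real.rpow_mul hPa.le,
      show -p * (1 / p) = -1 by field_simp, Real.rpow_neg_one, Real.rpow_neg hPn.le]
    have := Real.rpow_pos_of_pos hPn (1 / p)
    field_simp
  rw [mul_assoc ((1 - ρ) ^ 2), hw]
  rw [← add_assoc] at c2
  rw [show (n : ℝ) + (β + 1 + (β + 2) / η) = (n + β + 1) + (β + 2) / η by ring] at c2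
  set r := (n : ℝ) + β + 1 with hrdef
  set q := (β + 1) / p + ε with hq
  set K := (β + 2) / η with hK
  have hK0 : 0 < K := by positivity
  have hq0 : 0 < q := by positivity
  -- bound on X
  have hX : r * t / (1 - t) + (β + 2) ≤ t / (1 - t) * (r + K) := by
    have h3 : (β + 2) * (1 - t) ≤ t * K := by
      have : η * K = β + 2 := by rw [hK]; field_simp
      nlinarith [mul_le_mul_of_nonneg_right ht0 hK0.le]
    have : t / (1 - t) * (r + K) = r * t / (1 - t) + (t * K) / (1 - t) := by ring
    rw [this]
    have : β + 2 ≤ t * K / (1 - t) := by rw [le_div_iff₀ ht]; exact h3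
    linarith
  have hX2 : (t / (1 - t) * (r + K)) ^ (-q) ≤ (r * t / (1 - t) + (β + 2)) ^ (-q) :=
    Real.rpow_le_rpow_of_nonpos (by positivity) hX (by linarith)
  have c2' : 1 - ρ ≤ (r / (r + K)) ^ q := by
    refine c2.trans (Real.rpow_le_rpow_of_exponent_ge (by positivity) ?_ ?_)
    · rw [div_le_one (by positivity)]; linarith
    · rw [hq]; linarith
  have c1' : (poch n β / r ^ β) ^ (1 / p) = poch n β ^ (1 / p) * r ^ (-(β / p)) := by
    rw [Real.div_rpow hPn.le (by positivity), ← Real.rpow_mul hr.le, Real.rpow_neg hr.le,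
      div_eq_mul_inv]
    congr 3
    ring
  have key : (1 - ρ) ^ 2 * r ^ (-(1 / p) - ε) ≤ poch n β ^ (1 / p) * (r + K) ^ (-q) := by
    calc (1 - ρ) ^ 2 * r ^ (-(1 / p) - ε)
        ≤ ((poch n β / r ^ β) ^ (1 / p) * (r / (r + K)) ^ q) * r ^ (-(1 / p) - ε) := by
          rw [sq]
          have : 0 ≤ 1 - ρ := by linarith
          gcongr
      _ = poch n β ^ (1 / p) * (r + K) ^ (-q) := by
          rw [c1', Real.div_rpow hr.le (by positivity), Real.rpow_neg (by positivity : 0 ≤ r + K)]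
          have : r ^ (-(β / p)) * r ^ q * r ^ (-(1 / p) - ε) = 1 := by
            rw [← Real.rpow_add hr, ← Real.rpow_add hr]
            convert Real.rpow_zero r using 2
            rw [hq]; ring
          linear_combination (poch n β ^ (1 / p) * ((r + K) ^ q)⁻¹) * this
  have hF : (1 - t) ^ (-(1 - 1 / p) * (β + 1) + ε) * t ^ (-((β + 1) / p) - ε) =
      (1 - t) ^ (-(β + 1)) * (t / (1 - t)) ^ (-q) := by
    rw [Real.div_rpow ht'.le ht.le, Real.rpow_neg ht.le q, div_inv_eq_mul,
      show -(1 - 1 / p) * (β + 1) + ε = -(β + 1) + q by rw [hq]; ring, Real.rpow_add ht,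
      show -((β + 1) / p) - ε = -q by rw [hq]; ring]
    ring
  rw [hF]
  calc (1 - ρ) ^ 2 * r ^ (-(1 / p) - ε) * ((1 - t) ^ (-(β + 1)) * (t / (1 - t)) ^ (-q))
      ≤ poch n β ^ (1 / p) * (r + K) ^ (-q) * ((1 - t) ^ (-(β + 1)) * (t / (1 - t)) ^ (-q)) := by
        gcongr
    _ = poch n β ^ (1 / p) * (1 - t) ^ (-(β + 1)) * (t / (1 - t) * (r + K)) ^ (-q) := by
        rw [Real.mul_rpow (by positivity) (by positivity)]; ring
    _ ≤ _ := by gcongr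

/-- For `ρ, η ∈ (0,1/2)` there is `N₀ = N₀(ρ,η)` such that for every
`ε ∈ (0, (β+1)/p)` and every `n ≥ N₀`,
`w₂(n)^{1/p} A_n ≥ (1-ρ)² w₁(n)^{1/p} a_n ∫_η^{1-η} (1-t)^{-(1-1/p)(β+1)+ε} t^{-(β+1)/p-ε} dμ(t)`. -/
theorem claim_lower_bound (μ : Measure ℝ) [IsFiniteMeasure μ] (p α β : ℝ)
    (hp : 1 ≤ p) (hα : -1 < α) (hβ : -1 < β) (hβα : -1 < β - α)
    (ρ η : ℝ) (hρ : ρ ∈ Set.Ioo (0 : ℝ) (1 / 2)) (hη : η ∈ Set.Ioo (0 : ℝ) (1 / 2)) :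
    ∃ N₀ : ℕ, ∀ ε : ℝ, ε ∈ Set.Ioo (0 : ℝ) ((β + 1) / p) → ∀ n : ℕ, N₀ ≤ n →
      ENNReal.ofReal ((1 - ρ) ^ 2 * (w1 α β p n) ^ (1 / p) * aseq α β p ε n) *
        (∫⁻ t in Icc η (1 - η),
          ENNReal.ofReal ((1 - t) ^ (-(1 - 1 / p) * (β + 1) + ε) *
            t ^ (-((β + 1) / p) - ε)) ∂μ) ≤
      ENNReal.ofReal ((w2 α β p n) ^ (1 / p)) * Aseq μ α β p ε n := by
  obtain ⟨hρ0, hρ1⟩ := hρ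
  obtain ⟨hη0, hη1⟩ := hη
  obtain ⟨N, hN⟩ := exists_N (p := p) (K := (β + 2) / η) hβ hρ0
  refine ⟨N, fun ε hε n hn => ?_⟩
  obtain ⟨hε0, hε1⟩ := hε
  obtain ⟨c1, c2⟩ := hN n hn
  have hwn : 0 ≤ (w2 α β p n) ^ (1 / p) := by
    have h0 : (0 : ℝ) ≤ n := by positivity
    have h1 : 0 < poch ((n : ℝ) + β - α) α := poch_pos (by linarith) (by linarith)
    have h2 : 0 < poch (n : ℝ) β := poch_pos (by linarith) (by linarith)
    unfold w2
    positivity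
  have hcn : 0 ≤ (1 - ρ) ^ 2 * (w1 α β p n) ^ (1 / p) * aseq α β p ε n := by
    have h0 : (0 : ℝ) ≤ n := by positivity
    have h1 : 0 < poch (n : ℝ) α := poch_pos (by linarith) (by linarith)
    have h2 : 0 < poch (n : ℝ) β := poch_pos (by linarith) (by linarith)
    have h3 : 0 < (n : ℝ) + β + 1 := by linarith
    unfold w1 aseq
    positivity
  unfold Aseq
  rw [← ENNReal.tsum_mul_left, ← lintegral_const_mul' _ _ ENNReal.ofReal_ne_top]
  have hmeas : ∀ m : ℕ, Measurable fun t : ℝ => ENNReal.ofReal ((w2 α β p n) ^ (1 / p) *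
      (kker α β m n * t ^ m * (1 - t) ^ n * |aseq α β p ε m|)) := by
    intro m
    fun_prop
  calc _ ≤ ∫⁻ t in Icc η (1 - η), ∑' m : ℕ, ENNReal.ofReal ((w2 α β p n) ^ (1 / p) *
      (kker α β m n * t ^ m * (1 - t) ^ n * |aseq α β p ε m|)) ∂μ := by
        refine setLIntegral_mono' measurableSet_Icc fun t ht => ?_
        rw [← ENNReal.ofReal_mul hcn]
        refine le_trans (ENNReal.ofReal_le_ofReal ?_)
          (core_sum hp hα hβ hβα hε0 (by linarith [ht.1]) (by linarith [ht.2]) n)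
        exact real_bound hp hα hβ (by linarith) hη0 hε0 hε1 ht.1 (by linarith [ht.2]) c1 c2
    _ ≤ ∫⁻ t in Ioo (0 : ℝ) 1, ∑' m : ℕ, ENNReal.ofReal ((w2 α β p n) ^ (1 / p) *
      (kker α β m n * t ^ m * (1 - t) ^ n * |aseq α β p ε m|)) ∂μ :=
        lintegral_mono_set fun t ht => ⟨by linarith [ht.1], by linarith [ht.2]⟩
    _ = ∑' m : ℕ, ∫⁻ t in Ioo (0 : ℝ) 1, ENNReal.ofReal ((w2 α β p n) ^ (1 / p) *
      (kker α β m n * t ^ m * (1 - t) ^ n * |aseq α β p ε m|)) ∂μ :=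
        lintegral_tsum fun m => (hmeas m).aemeasurable
    _ ≤ _ := by
        refine ENNReal.tsum_le_tsum fun m => ?_
        rw [← lintegral_const_mul' _ _ ENNReal.ofReal_ne_top]
        refine le_of_eq (lintegral_congr fun t => ?_)
        rw [ENNReal.ofReal_mul hwn]
end

section
/- Let β > -1 and let μ be a positive finite Borel measure on (0,1). The operator H_μ^β is bounded on the Dirichlet-type space D_{1-β} (equivalently, there is M such that ∑_{n=0}^∞ (n+1)^β |H_μ^β(a)(n)|² ≤ M² ∑_{m=0}^∞ (m+1)^β |a_m|² for all coefficient sequences a with ∑_m (m+1)^β |a_m|² < ∞) if and only if C_β(μ) = ∫_{(0,1)} (1-t)^{-(β+1)/2} t^{-(β+1)/2} dμ(t) < ∞. -/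
open MeasureTheory Set

/-- The generalized binomial coefficient `binom(γ, m) = γ(γ-1)⋯(γ-m+1)/m!`. -/
noncomputable def gbinom (γ : ℝ) (m : ℕ) : ℝ :=
  (∏ i ∈ Finset.range m, (γ - (i : ℝ))) / (m.factorial : ℝ)

/-- The operator `H_μ^β(a)(n) = ∑_m ∫_{(0,1)} binom(n+m+β, m) t^m (1-t)^n a_m dμ(t)`,
acting on the Taylor-coefficient sequence of an analytic function. -/
noncomputable def Hb (μ : Measure ℝ) (β : ℝ) (a : ℕ → ℂ) (n : ℕ) : ℂ :=
  ∑' m : ℕ,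
    ∫ t in Ioo (0 : ℝ) 1, (gbinom ((n : ℝ) + (m : ℝ) + β) m * t ^ m * (1 - t) ^ n) • a m ∂μ

open Filter Topology
open scoped ENNReal

/-- The natural weight, comparable to `(n+1)^β`. -/
noncomputable def Wt (β : ℝ) (n : ℕ) : ℝ := gbinom ((n : ℝ) + β) n

lemma gbinom_pos {β : ℝ} (hβ : -1 < β) (n m : ℕ) : 0 < gbinom ((n : ℝ) + m + β) m := by
  unfold gbinom
  apply div_pos _ (by positivity)
  apply Finset.prod_pos
  intro i hi
  have h : i + 1 ≤ m := by simpa using hi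
  have h2 : (i : ℝ) + 1 ≤ m := by exact_mod_cast h
  have h3 : (0 : ℝ) ≤ n := by positivity
  linarith

lemma Wt_pos {β : ℝ} (hβ : -1 < β) (n : ℕ) : 0 < Wt β n := by
  have := gbinom_pos hβ 0 n
  simpa [Wt] using this

lemma Wt_mul_gbinom (β : ℝ) (n m : ℕ) :
    Wt β n * gbinom ((n : ℝ) + m + β) m =
      (∏ i ∈ Finset.range (m + n), ((n : ℝ) + m + β - i)) / (n.factorial * m.factorial) := by
  unfold Wt gbinom
  rw [Finset.prod_range_add]
  have : ∀ i : ℕ, (n : ℝ) + m + β - ((m + i : ℕ) : ℝ) = n + β - i := by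
    intro i; push_cast; ring
  simp_rw [this]
  field_simp

lemma Wt_symm (β : ℝ) (n m : ℕ) :
    Wt β n * gbinom ((n : ℝ) + m + β) m = Wt β m * gbinom ((m : ℝ) + n + β) n := by
  rw [Wt_mul_gbinom, Wt_mul_gbinom, add_comm m n, add_comm (n : ℝ) m, mul_comm (n.factorial : ℝ)]

lemma choose_eq_gbinom (γ : ℝ) (m : ℕ) : Ring.choose γ m = gbinom γ m := by
  rw [Ring.choose_eq_smul, Polynomial.descPochhammer_smeval_eq_ascPochhammer,
    Polynomial.ascPochhammer_smeval_eq_eval, ← descPochhammer_eval_eq_ascPochhammer,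
    descPochhammer_eval_eq_prod_range, gbinom]
  simp only [smul_eq_mul]
  rw [div_eq_inv_mul]

lemma hasSum_gbinom (β : ℝ) (n : ℕ) {x : ℝ} (h0 : 0 ≤ x) (h1 : x < 1) :
    HasSum (fun m : ℕ => gbinom ((n : ℝ) + m + β) m * x ^ m) ((1 - x) ^ (-((n : ℝ) + β + 1))) := by
  have h := (Real.one_div_one_sub_rpow_hasFPowerSeriesOnBall_zero ((n : ℝ) + β + 1)).hasSum
    (y := x) (by
      rw [Metric.mem_eball, edist_zero_right, Real.enorm_eq_ofReal h0]
      simpa using h1)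
  simp only [FormalMultilinearSeries.ofScalars_apply_eq, zero_add, choose_eq_gbinom, smul_eq_mul] at h
  rw [Real.rpow_neg (by linarith), ← one_div]
  have e : ∀ m : ℕ, (n : ℝ) + β + 1 + m - 1 = n + m + β := fun m => by ring
  simp only [e] at h
  exact h

lemma tsum_gbinom {β : ℝ} (hβ : -1 < β) (n : ℕ) {x : ℝ} (h0 : 0 ≤ x) (h1 : x < 1) :
    ∑' m : ℕ, ENNReal.ofReal (gbinom ((n : ℝ) + m + β) m * x ^ m) =
      ENNReal.ofReal ((1 - x) ^ (-((n : ℝ) + β + 1))) := by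
  have h := hasSum_gbinom β n h0 h1
  rw [← h.tsum_eq, ENNReal.ofReal_tsum_of_nonneg _ h.summable]
  intro m
  have := gbinom_pos hβ n m
  positivity

lemma tsum_Wt {β : ℝ} (hβ : -1 < β) {x : ℝ} (h0 : 0 ≤ x) (h1 : x < 1) :
    ∑' m : ℕ, ENNReal.ofReal (Wt β m * x ^ m) = ENNReal.ofReal ((1 - x) ^ (-(β + 1))) := by
  have := tsum_gbinom hβ 0 h0 h1
  simpa [Wt] using this

lemma Wt_bounds {β : ℝ} (hβ : -1 < β) : ∃ c C : ℝ, 0 < c ∧ 0 < C ∧ ∀ n : ℕ,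
    Wt β n ≤ C * ((n : ℝ) + 1) ^ β ∧ ((n : ℝ) + 1) ^ β ≤ c * Wt β n := by
  set s := β + 1 with hs
  have hs0 : 0 < s := by linarith
  have hW : ∀ n : ℕ, Wt β n = (∏ j ∈ Finset.range n, (s + j)) / n.factorial := by
    intro n
    unfold Wt gbinom
    rw [← Finset.prod_range_reflect]
    congr 1
    apply Finset.prod_congr rfl
    intro i hi
    have h : i + 1 ≤ n := by simpa using hi
    rw [Nat.sub_sub, Nat.cast_sub (by omega)]
    push_cast
    ring
  have hpos : ∀ n : ℕ, 0 < (n : ℝ) + 1 := fun n => by positivity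
  have hρ : ∀ n : ℕ, 1 ≤ n → (Real.GammaSeq s n)⁻¹ * ((n : ℝ) / (n + 1)) ^ s *
      (((n : ℝ) / (n + s)) / (n / (n + 1))) = Wt β n / ((n : ℝ) + 1) ^ β := by
    intro n hn
    have hn' : (0 : ℝ) < n := by exact_mod_cast hn
    rw [hW, Real.GammaSeq, Finset.prod_range_succ, Real.div_rpow hn'.le (hpos n).le]
    have hp : 0 < ∏ j ∈ Finset.range n, (s + (j : ℝ)) := Finset.prod_pos fun j _ => by positivity
    have h2 : ((n : ℝ) + 1) ^ s = ((n : ℝ) + 1) ^ β * (n + 1) := by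
      rw [hs, Real.rpow_add_one (hpos n).ne']
    rw [h2]
    have h3 : 0 < ((n : ℝ) + 1) ^ β := Real.rpow_pos_of_pos (hpos n) _
    have h4 : 0 < (n : ℝ) ^ s := Real.rpow_pos_of_pos hn' _
    have h5 : 0 < (n : ℝ) + s := by positivity
    field_simp
    ring
  have hG := Real.Gamma_pos_of_pos hs0
  have t1 : Tendsto (fun n : ℕ => (n : ℝ) / (n + 1)) atTop (𝓝 1) :=
    tendsto_natCast_div_add_atTop 1
  have t2 : Tendsto (fun n : ℕ => (n : ℝ) / (n + s)) atTop (𝓝 1) :=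
    tendsto_natCast_div_add_atTop s
  have t3 := t1.rpow_const (p := s) (Or.inl one_ne_zero)
  have t4 := (((Real.GammaSeq_tendsto_Gamma s).inv₀ hG.ne').mul t3).mul (t2.div t1 one_ne_zero)
  simp only [Real.one_rpow, mul_one, div_one] at t4
  have t5 : Tendsto (fun n : ℕ => Wt β n / ((n : ℝ) + 1) ^ β) atTop (𝓝 (Real.Gamma s)⁻¹) := by
    refine t4.congr' ?_
    filter_upwards [eventually_ge_atTop 1] with n hn using hρ n hn
  have t6 := t5.inv₀ (inv_pos.2 hG).ne'
  obtain ⟨C, hC⟩ := t5.bddAbove_range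
  obtain ⟨c, hc⟩ := t6.bddAbove_range
  have hC' : ∀ n : ℕ, Wt β n / ((n : ℝ) + 1) ^ β ≤ C := fun n => hC ⟨n, rfl⟩
  have hc' : ∀ n : ℕ, (Wt β n / ((n : ℝ) + 1) ^ β)⁻¹ ≤ c := fun n => hc ⟨n, rfl⟩
  have hr : ∀ n : ℕ, 0 < Wt β n / ((n : ℝ) + 1) ^ β := fun n =>
    div_pos (Wt_pos hβ n) (Real.rpow_pos_of_pos (hpos n) _)
  refine ⟨c, C, (inv_pos.2 (hr 0)).trans_le (hc' 0), (hr 0).trans_le (hC' 0), fun n => ⟨?_, ?_⟩⟩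
  · have := hC' n
    rwa [div_le_iff₀ (Real.rpow_pos_of_pos (hpos n) _)] at this
  · have := hc' n
    rwa [inv_div, div_le_iff₀ (Wt_pos hβ n)] at this

/-- The kernel. -/
noncomputable def Kt (β : ℝ) (n m : ℕ) (t : ℝ) : ℝ≥0∞ :=
  ENNReal.ofReal (gbinom ((n : ℝ) + m + β) m * t ^ m * (1 - t) ^ n)

/-- The integrated kernel. -/
noncomputable def kap (μ : Measure ℝ) (β : ℝ) (n m : ℕ) : ℝ≥0∞ :=
  ∫⁻ t in Ioo (0 : ℝ) 1, Kt β n m t ∂μ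

lemma Kt_meas (β : ℝ) (n m : ℕ) : Measurable (Kt β n m) := by
  unfold Kt; fun_prop

lemma Kre_nonneg {β : ℝ} (hβ : -1 < β) (n m : ℕ) {t : ℝ} (ht : t ∈ Ioo (0 : ℝ) 1) :
    0 ≤ gbinom ((n : ℝ) + m + β) m * t ^ m * (1 - t) ^ n := by
  have := gbinom_pos hβ n m
  have h1 := ht.1
  have h2 : 0 < 1 - t := by linarith [ht.2]
  positivity

lemma Kt_symm {β : ℝ} (hβ : -1 < β) (n m : ℕ) (t : ℝ) :
    ENNReal.ofReal (Wt β n) * Kt β n m t = ENNReal.ofReal (Wt β m) * Kt β m n (1 - t) := by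
  unfold Kt
  rw [← ENNReal.ofReal_mul (Wt_pos hβ n).le, ← ENNReal.ofReal_mul (Wt_pos hβ m).le]
  congr 1
  have := Wt_symm β n m
  rw [sub_sub_cancel]
  linear_combination (t ^ m * (1 - t) ^ n) * this

lemma Kt_row_geom {β : ℝ} (hβ : -1 < β) (n : ℕ) {t r : ℝ} (ht : t ∈ Ioo (0 : ℝ) 1)
    (hr0 : 0 ≤ r) (hr1 : r ≤ 1) :
    ∑' m : ℕ, Kt β n m t * ENNReal.ofReal (r ^ m) =
      ENNReal.ofReal ((1 - t) ^ n * (1 - t * r) ^ (-((n : ℝ) + β + 1))) := by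
  have h2 : 0 < 1 - t := by linarith [ht.2]
  have htr : t * r < 1 := by nlinarith [ht.1, ht.2]
  rw [ENNReal.ofReal_mul (by positivity), ← tsum_gbinom hβ n (mul_nonneg ht.1.le hr0) htr,
    ← ENNReal.tsum_mul_left]
  congr 1
  ext m
  unfold Kt
  rw [← ENNReal.ofReal_mul (Kre_nonneg hβ n m ht), ← ENNReal.ofReal_mul (by positivity)]
  congr 1
  rw [mul_pow]; ring

lemma Kt_row {β : ℝ} (hβ : -1 < β) (n : ℕ) {t : ℝ} (ht : t ∈ Ioo (0 : ℝ) 1) :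
    ∑' m : ℕ, Kt β n m t = ENNReal.ofReal ((1 - t) ^ (-(β + 1))) := by
  have h2 : 0 < 1 - t := by linarith [ht.2]
  have h := Kt_row_geom hβ n ht zero_le_one le_rfl
  simp only [one_pow, ENNReal.ofReal_one, mul_one] at h
  rw [h, ← Real.rpow_natCast, ← Real.rpow_add h2]
  congr 2
  ring

lemma Kt_col {β : ℝ} (hβ : -1 < β) (m : ℕ) {t : ℝ} (ht : t ∈ Ioo (0 : ℝ) 1) :
    ∑' n : ℕ, ENNReal.ofReal (Wt β n) * Kt β n m t =
      ENNReal.ofReal (Wt β m) * ENNReal.ofReal (t ^ (-(β + 1))) := by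
  simp_rw [Kt_symm hβ _ m t]
  rw [ENNReal.tsum_mul_left, Kt_row hβ m (t := 1 - t) ⟨by linarith [ht.2], by linarith [ht.1]⟩,
    sub_sub_cancel]

lemma Kt_pair {β : ℝ} (hβ : -1 < β) {t x y : ℝ} (ht : t ∈ Ioo (0 : ℝ) 1)
    (hx : x ∈ Ioo (0 : ℝ) 1) (hy : y ∈ Ioo (0 : ℝ) 1) :
    ∑' n : ℕ, ∑' m : ℕ, ENNReal.ofReal (Wt β n) * ENNReal.ofReal ((1 - y) ^ n) *
        (Kt β n m t * ENNReal.ofReal ((1 - x) ^ m)) =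
      ENNReal.ofReal ((t * x + (1 - t) * y) ^ (-(β + 1))) := by
  obtain ⟨ht0, ht1⟩ := ht
  obtain ⟨hx0, hx1⟩ := hx
  obtain ⟨hy0, hy1⟩ := hy
  have h2 : 0 < 1 - t := by linarith
  have hy2 : 0 < 1 - y := by linarith
  have hd : 0 < 1 - t * (1 - x) := by nlinarith
  set q := (1 - y) * (1 - t) / (1 - t * (1 - x)) with hq
  have hq0 : 0 ≤ q := by positivity
  have hq1 : q < 1 := by
    rw [hq, div_lt_one hd]; nlinarith [mul_pos ht0 hx0, mul_pos h2 hy0]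
  have hfin : (1 - q) * (1 - t * (1 - x)) = t * x + (1 - t) * y := by
    rw [hq, sub_mul, div_mul_cancel₀ _ hd.ne']; ring
  rw [← hfin, Real.mul_rpow (by linarith) hd.le, ENNReal.ofReal_mul (by
    apply Real.rpow_nonneg; linarith), ← tsum_Wt hβ hq0 hq1, ← ENNReal.tsum_mul_right]
  congr 1
  ext n
  rw [ENNReal.tsum_mul_left, Kt_row_geom hβ n ⟨ht0, ht1⟩ (by linarith) (by linarith)]
  have hw := Wt_pos hβ n
  rw [← ENNReal.ofReal_mul hw.le, ← ENNReal.ofReal_mul (by positivity),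
    ← ENNReal.ofReal_mul (by positivity)]
  congr 1
  have : (1 - t * (1 - x)) ^ (-((n : ℝ) + β + 1)) =
      ((1 - t * (1 - x)) ^ n)⁻¹ * (1 - t * (1 - x)) ^ (-(β + 1)) := by
    rw [← Real.rpow_natCast, ← Real.rpow_neg hd.le, ← Real.rpow_add hd]
    congr 1; ring
  rw [this, hq, div_pow, mul_pow]
  field_simp

lemma enorm_Hb_le {μ : Measure ℝ} {β : ℝ} (hβ : -1 < β) (a : ℕ → ℂ) (n : ℕ) :
    ‖Hb μ β a n‖ₑ ≤ ∑' m, kap μ β n m * ‖a m‖ₑ := by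
  unfold Hb
  refine enorm_tsum_le_tsum_enorm.trans (ENNReal.tsum_le_tsum fun m => ?_)
  refine (enorm_integral_le_lintegral_enorm _).trans ?_
  unfold kap
  rw [← lintegral_mul_const _ (Kt_meas β n m)]
  refine lintegral_mono_ae ?_
  filter_upwards [ae_restrict_mem measurableSet_Ioo] with t ht
  rw [enorm_smul, Real.enorm_eq_ofReal (Kre_nonneg hβ n m ht), Kt]

lemma K_int (μ : Measure ℝ) [IsFiniteMeasure μ] {β : ℝ} (n m : ℕ) :
    IntegrableOn (fun t : ℝ => gbinom ((n : ℝ) + m + β) m * t ^ m * (1 - t) ^ n)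
      (Ioo (0 : ℝ) 1) μ := by
  have : IntegrableOn (fun t : ℝ => gbinom ((n : ℝ) + m + β) m * t ^ m * (1 - t) ^ n)
      (Icc (0 : ℝ) 1) μ := by
    apply ContinuousOn.integrableOn_compact isCompact_Icc
    fun_prop
  exact this.mono_set Ioo_subset_Icc_self

lemma enorm_Hb_trunc {μ : Measure ℝ} [IsFiniteMeasure μ] {β : ℝ} (hβ : -1 < β) (A : ℕ → ℝ)
    (hA : ∀ m, 0 ≤ A m) (N n : ℕ) :
    ‖Hb μ β (fun m => if m < N then (A m : ℂ) else 0) n‖ₑ =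
      ∑ m ∈ Finset.range N, kap μ β n m * ENNReal.ofReal (A m) := by
  unfold Hb
  rw [tsum_eq_sum (s := Finset.range N)]
  swap
  · intro m hm
    have : ¬ m < N := by simpa using hm
    simp [this]
  have h0 : ∀ m : ℕ, 0 ≤ ∫ t in Ioo (0 : ℝ) 1,
      gbinom ((n : ℝ) + m + β) m * t ^ m * (1 - t) ^ n ∂μ := fun m =>
    setIntegral_nonneg measurableSet_Ioo fun t ht => Kre_nonneg hβ n m ht
  have h1 : ∀ m ∈ Finset.range N, ∫ t in Ioo (0 : ℝ) 1,
      (gbinom ((n : ℝ) + m + β) m * t ^ m * (1 - t) ^ n) •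
        (if m < N then (A m : ℂ) else 0) ∂μ =
      (((∫ t in Ioo (0 : ℝ) 1,
      gbinom ((n : ℝ) + m + β) m * t ^ m * (1 - t) ^ n ∂μ) * A m : ℝ) : ℂ) := by
    intro m hm
    have : m < N := by simpa using hm
    rw [if_pos this, integral_smul_const, Complex.real_smul, Complex.ofReal_mul]
  rw [Finset.sum_congr rfl h1, ← Complex.ofReal_sum, ← ofReal_norm, Complex.norm_real,
    Real.norm_of_nonneg (Finset.sum_nonneg fun m _ => mul_nonneg (h0 m) (hA m)),
    ENNReal.ofReal_sum_of_nonneg (fun m _ => mul_nonneg (h0 m) (hA m))]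
  refine Finset.sum_congr rfl fun m _ => ?_
  rw [ENNReal.ofReal_mul (h0 m), ofReal_integral_eq_lintegral_ofReal (K_int μ n m)]
  · rfl
  · filter_upwards [ae_restrict_mem measurableSet_Ioo] with t ht using Kre_nonneg hβ n m ht

lemma cs_lintegral {α : Type*} [MeasurableSpace α] (ν : Measure α) {f g : α → ℝ≥0∞}
    (hf : AEMeasurable f ν) (hg : AEMeasurable g ν) :
    (∫⁻ x, f x * g x ∂ν) ^ 2 ≤ (∫⁻ x, f x ^ 2 ∂ν) * ∫⁻ x, g x ^ 2 ∂ν := by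
  have h := ENNReal.lintegral_mul_le_Lp_mul_Lq ν Real.HolderConjugate.two_two hf hg
  have h2 := pow_le_pow_left₀ (zero_le) h 2
  refine h2.trans (le_of_eq ?_)
  rw [mul_pow]
  simp only [← ENNReal.rpow_natCast, ← ENNReal.rpow_mul]
  norm_num

lemma cs_tsum (f g : ℕ → ℝ≥0∞) :
    (∑' x, f x * g x) ^ 2 ≤ (∑' x, f x ^ 2) * ∑' x, g x ^ 2 := by
  have := cs_lintegral Measure.count (f := f) (g := g) (by fun_prop) (by fun_prop)
  simpa [lintegral_count] using this

/-- The density in `C_β(μ)`. -/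
noncomputable def hd (β t : ℝ) : ℝ := (1 - t) ^ (-((β + 1) / 2)) * t ^ (-((β + 1) / 2))

lemma suff_core (μ : Measure ℝ) {β : ℝ} (hβ : -1 < β) (A : ℕ → ℝ≥0∞) :
    ∑' n, ENNReal.ofReal (Wt β n) * (∑' m, kap μ β n m * A m) ^ 2 ≤
      (∫⁻ t in Ioo (0 : ℝ) 1, ENNReal.ofReal (hd β t) ∂μ) ^ 2 *
        ∑' m, ENNReal.ofReal (Wt β m) * A m ^ 2 := by
  set γ := (β + 1) / 2 with hγ
  set C := ∫⁻ t in Ioo (0 : ℝ) 1, ENNReal.ofReal (hd β t) ∂μ with hC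
  set p : ℝ → ℝ≥0∞ := fun t => ENNReal.ofReal ((1 - t) ^ γ * t ^ (-γ)) with hp
  set q : ℝ → ℝ≥0∞ := fun t => ENNReal.ofReal ((1 - t) ^ (-γ) * t ^ γ) with hq
  have mp : Measurable p := by rw [hp]; fun_prop
  have mq : Measurable q := by rw [hq]; fun_prop
  set P : ℕ → ℕ → ℝ≥0∞ := fun n m => ∫⁻ t in Ioo (0 : ℝ) 1, Kt β n m t * p t ∂μ with hP
  set Q : ℕ → ℕ → ℝ≥0∞ := fun n m => ∫⁻ t in Ioo (0 : ℝ) 1, Kt β n m t * q t ∂μ with hQ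
  have sq : ∀ z : ℝ≥0∞, (z ^ (1 / 2 : ℝ)) ^ 2 = z := by
    intro z
    rw [← ENNReal.rpow_natCast, ← ENNReal.rpow_mul]; norm_num
  have hk : ∀ n m, kap μ β n m ^ 2 ≤ P n m * Q n m := by
    intro n m
    have h := cs_lintegral (μ.restrict (Ioo (0 : ℝ) 1))
      (f := fun t => (Kt β n m t * p t) ^ (1 / 2 : ℝ))
      (g := fun t => (Kt β n m t * q t) ^ (1 / 2 : ℝ))
      (((Kt_meas β n m).mul mp).pow_const _).aemeasurable
      (((Kt_meas β n m).mul mq).pow_const _).aemeasurable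
    simp only [sq] at h
    refine le_trans (le_of_eq ?_) h
    congr 1
    refine setLIntegral_congr_fun measurableSet_Ioo fun t ht => ?_
    have ht0 := ht.1
    have ht1 : 0 < 1 - t := by linarith [ht.2]
    have hpq : p t * q t = 1 := by
      rw [hp, hq]
      simp only
      rw [← ENNReal.ofReal_mul (by positivity), Real.rpow_neg ht0.le, Real.rpow_neg ht1.le,
        ← ENNReal.ofReal_one]
      congr 1
      have := Real.rpow_pos_of_pos ht0 γ
      have := Real.rpow_pos_of_pos ht1 γ
      field_simp
    rw [← ENNReal.mul_rpow_of_nonneg _ _ (by norm_num), mul_mul_mul_comm, hpq, mul_one, ← pow_two,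
      ← ENNReal.rpow_natCast, ← ENNReal.rpow_mul]
    norm_num
  have hPs : ∀ n, ∑' m, P n m = C := by
    intro n
    rw [hP]
    simp only
    have mm : ∀ m, Measurable fun t => Kt β n m t * p t := fun m => (Kt_meas β n m).mul mp
    rw [← lintegral_tsum fun m => (mm m).aemeasurable, hC]
    refine setLIntegral_congr_fun measurableSet_Ioo fun t ht => ?_
    have ht0 := ht.1
    have ht1 : 0 < 1 - t := by linarith [ht.2]
    rw [ENNReal.tsum_mul_right, Kt_row hβ n ht, hp]
    simp only
    rw [← ENNReal.ofReal_mul (by positivity), ← mul_assoc, ← Real.rpow_add ht1, hd]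
    congr 3
    rw [hγ]; ring
  have hQs : ∀ m, ∑' n, ENNReal.ofReal (Wt β n) * Q n m = ENNReal.ofReal (Wt β m) * C := by
    intro m
    rw [hQ]
    simp only
    have mm : ∀ n, Measurable fun t => Kt β n m t * q t := fun n => (Kt_meas β n m).mul mq
    have e : ∀ n, ENNReal.ofReal (Wt β n) * ∫⁻ t in Ioo (0 : ℝ) 1, Kt β n m t * q t ∂μ =
        ∫⁻ t in Ioo (0 : ℝ) 1, ENNReal.ofReal (Wt β n) * (Kt β n m t * q t) ∂μ :=
      fun n => (lintegral_const_mul _ (mm n)).symm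
    simp only [e]
    rw [← lintegral_tsum fun n => ((mm n).const_mul _).aemeasurable, hC,
      ← lintegral_const_mul' _ _ ENNReal.ofReal_ne_top]
    refine setLIntegral_congr_fun measurableSet_Ioo fun t ht => ?_
    have ht0 := ht.1
    have ht1 : 0 < 1 - t := by linarith [ht.2]
    simp only [← mul_assoc]
    rw [ENNReal.tsum_mul_right, Kt_col hβ m ht, hq, mul_assoc]
    simp only
    rw [← ENNReal.ofReal_mul (by positivity), mul_left_comm, ← Real.rpow_add ht0, hd]
    congr 4
    rw [hγ]; ring
  have hrow : ∀ n, (∑' m, kap μ β n m * A m) ^ 2 ≤ C * ∑' m, Q n m * A m ^ 2 := by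
    intro n
    have h := cs_tsum (fun m => P n m ^ (1 / 2 : ℝ)) (fun m => Q n m ^ (1 / 2 : ℝ) * A m)
    simp only [mul_pow, sq, hPs] at h
    refine le_trans ?_ h
    refine pow_le_pow_left₀ zero_le (ENNReal.tsum_le_tsum fun m => ?_) 2
    rw [← mul_assoc, ← ENNReal.mul_rpow_of_nonneg _ _ (by norm_num)]
    gcongr
    have h3 := ENNReal.rpow_le_rpow (hk n m) (z := 1 / 2) (by norm_num)
    rw [← ENNReal.rpow_natCast, ← ENNReal.rpow_mul] at h3
    norm_num at h3 ⊢
    exact h3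
  calc _ ≤ ∑' n, ENNReal.ofReal (Wt β n) * (C * ∑' m, Q n m * A m ^ 2) := by
        gcongr with n; exact hrow n
    _ = C * ∑' n, ∑' m, ENNReal.ofReal (Wt β n) * Q n m * A m ^ 2 := by
        rw [← ENNReal.tsum_mul_left]
        congr 1; ext n
        rw [mul_left_comm, ← ENNReal.tsum_mul_left]
        simp only [mul_assoc]
    _ = C * ∑' m, ENNReal.ofReal (Wt β m) * C * A m ^ 2 := by
        rw [ENNReal.tsum_comm]
        simp only [ENNReal.tsum_mul_right, hQs]
    _ = C ^ 2 * ∑' m, ENNReal.ofReal (Wt β m) * A m ^ 2 := by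
        rw [pow_two, mul_assoc]
        congr 1
        rw [← ENNReal.tsum_mul_left]
        refine tsum_congr fun m => ?_
        ring

lemma ofReal_mul_norm_sq (w : ℝ) (hw : 0 ≤ w) (z : ℂ) :
    ENNReal.ofReal (w * ‖z‖ ^ 2) = ENNReal.ofReal w * ‖z‖ₑ ^ 2 := by
  rw [ENNReal.ofReal_mul hw, ENNReal.ofReal_pow (norm_nonneg _), ofReal_norm]

/-- Boundedness, as in the theorem. -/
def Bdd (μ : Measure ℝ) (β M : ℝ) : Prop := ∀ a : ℕ → ℂ,
        Summable (fun m : ℕ => ((m : ℝ) + 1) ^ β * ‖a m‖ ^ 2) →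
        ∑' n : ℕ, ENNReal.ofReal (((n : ℝ) + 1) ^ β * ‖Hb μ β a n‖ ^ 2) ≤
          ENNReal.ofReal (M ^ 2) *
            ∑' m : ℕ, ENNReal.ofReal (((m : ℝ) + 1) ^ β * ‖a m‖ ^ 2)

lemma nec_ext {μ : Measure ℝ} [IsFiniteMeasure μ] {β M c C : ℝ} (hβ : -1 < β) (hc : 0 < c)
    (hC : 0 < C) (hW : ∀ n : ℕ, Wt β n ≤ C * ((n : ℝ) + 1) ^ β ∧ ((n : ℝ) + 1) ^ β ≤ c * Wt β n)
    (h : Bdd μ β M) (A : ℕ → ℝ) (hA : ∀ m, 0 ≤ A m) :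
    ∑' n, ENNReal.ofReal (Wt β n) * (∑' m, kap μ β n m * ENNReal.ofReal (A m)) ^ 2 ≤
      (ENNReal.ofReal C * ENNReal.ofReal (M ^ 2) * ENNReal.ofReal c) *
        ∑' m, ENNReal.ofReal (Wt β m) * ENNReal.ofReal (A m) ^ 2 := by
  have hw : ∀ n : ℕ, 0 ≤ ((n : ℝ) + 1) ^ β := fun n => by positivity
  set R := (ENNReal.ofReal C * ENNReal.ofReal (M ^ 2) * ENNReal.ofReal c) *
        ∑' m, ENNReal.ofReal (Wt β m) * ENNReal.ofReal (A m) ^ 2 with hR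
  have key : ∀ N : ℕ, ∑' n, ENNReal.ofReal (Wt β n) *
      (∑ m ∈ Finset.range N, kap μ β n m * ENNReal.ofReal (A m)) ^ 2 ≤ R := by
    intro N
    have h1 := h (fun m => if m < N then (A m : ℂ) else 0) (by
      apply summable_of_ne_finset_zero (s := Finset.range N)
      intro m hm
      have : ¬ m < N := by simpa using hm
      simp [this])
    simp only [ofReal_mul_norm_sq _ (hw _), enorm_Hb_trunc hβ A hA N] at h1
    calc _ ≤ ∑' n : ℕ, ENNReal.ofReal C * (ENNReal.ofReal (((n : ℝ) + 1) ^ β) *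
      (∑ m ∈ Finset.range N, kap μ β n m * ENNReal.ofReal (A m)) ^ 2) := by
          refine ENNReal.tsum_le_tsum fun n => ?_
          rw [← mul_assoc, ← ENNReal.ofReal_mul hC.le]
          gcongr
          exact (hW n).1
      _ ≤ ENNReal.ofReal C * (ENNReal.ofReal (M ^ 2) * ∑' m : ℕ, ENNReal.ofReal c *
          (ENNReal.ofReal (Wt β m) * ENNReal.ofReal (A m) ^ 2)) := by
          rw [ENNReal.tsum_mul_left]
          refine mul_le_mul_right (h1.trans (mul_le_mul_right (ENNReal.tsum_le_tsum fun m => ?_) _)) _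
          rw [← mul_assoc, ← ENNReal.ofReal_mul hc.le]
          refine mul_le_mul' (ENNReal.ofReal_le_ofReal (hW m).2) ?_
          refine pow_le_pow_left₀ zero_le ?_ 2
          split_ifs
          · rw [← ofReal_norm, Complex.norm_real, Real.norm_of_nonneg (hA m)]
          · simp
      _ = R := by rw [ENNReal.tsum_mul_left, hR]; ring
  rw [ENNReal.tsum_eq_iSup_sum]
  refine iSup_le fun s => ?_
  have ht : Tendsto (fun N : ℕ => ∑ n ∈ s, ENNReal.ofReal (Wt β n) *
      (∑ m ∈ Finset.range N, kap μ β n m * ENNReal.ofReal (A m)) ^ 2) atTop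
      (𝓝 (∑ n ∈ s, ENNReal.ofReal (Wt β n) *
        (∑' m, kap μ β n m * ENNReal.ofReal (A m)) ^ 2)) := by
    refine tendsto_finsetSum _ fun n _ => ?_
    exact ENNReal.Tendsto.const_mul (ENNReal.Tendsto.pow (ENNReal.tendsto_nat_tsum _))
      (Or.inr ENNReal.ofReal_ne_top)
  exact le_of_tendsto' ht fun N => (ENNReal.sum_le_tsum s).trans (key N)

/-- Dyadic points. -/
noncomputable def xx (j : ℕ) : ℝ := (1 / 2) ^ (j + 1)

lemma xx_pos (j : ℕ) : 0 < xx j := by unfold xx; positivity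

lemma xx_lt (j : ℕ) : xx j < 1 := by
  unfold xx
  exact pow_lt_one₀ (by norm_num) (by norm_num) (by omega)

lemma xx_add (j d : ℕ) : xx (j + d) = xx j * (1 / 2) ^ d := by
  unfold xx
  ring

/-- The test sequence. -/
noncomputable def AA (β : ℝ) (J m : ℕ) : ℝ :=
  ∑ j ∈ Finset.range J, xx j ^ ((β + 1) / 2) * (1 - xx j) ^ m

lemma AA_term_nonneg (β : ℝ) (j m : ℕ) : 0 ≤ xx j ^ ((β + 1) / 2) * (1 - xx j) ^ m := by
  have h1 := xx_pos j
  have h2 : 0 < 1 - xx j := by linarith [xx_lt j]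
  positivity

lemma AA_nonneg (β : ℝ) (J m : ℕ) : 0 ≤ AA β J m :=
  Finset.sum_nonneg fun j _ => AA_term_nonneg β j m

lemma AA_ofReal (β : ℝ) (J m : ℕ) : ENNReal.ofReal (AA β J m) =
    ∑ j ∈ Finset.range J, ENNReal.ofReal (xx j ^ ((β + 1) / 2)) *
      ENNReal.ofReal ((1 - xx j) ^ m) := by
  unfold AA
  rw [ENNReal.ofReal_sum_of_nonneg fun j _ => AA_term_nonneg β j m]
  refine Finset.sum_congr rfl fun j _ => ?_
  have h1 := xx_pos j
  rw [ENNReal.ofReal_mul (by positivity)]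

lemma norm_term {β : ℝ} (hβ : -1 < β) (j d : ℕ) :
    xx j ^ ((β + 1) / 2) * xx (j + d) ^ ((β + 1) / 2) *
      (1 - (1 - xx j) * (1 - xx (j + d))) ^ (-(β + 1)) ≤ ((1 / 2 : ℝ) ^ ((β + 1) / 2)) ^ d := by
  have h1 := xx_pos j
  have h2 := xx_pos (j + d)
  have h3 := xx_lt j
  have h4 : xx j ≤ 1 - (1 - xx j) * (1 - xx (j + d)) := by nlinarith
  have h5 : (1 - (1 - xx j) * (1 - xx (j + d))) ^ (-(β + 1)) ≤ xx j ^ (-(β + 1)) :=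
    Real.rpow_le_rpow_of_nonpos h1 h4 (by linarith)
  calc _ ≤ xx j ^ ((β + 1) / 2) * xx (j + d) ^ ((β + 1) / 2) * xx j ^ (-(β + 1)) := by
        gcongr
    _ = _ := by
        rw [xx_add, Real.mul_rpow h1.le (by positivity)]
        have e : xx j ^ (-(β + 1)) = (xx j ^ ((β + 1) / 2))⁻¹ * (xx j ^ ((β + 1) / 2))⁻¹ := by
          rw [← Real.rpow_neg h1.le, ← Real.rpow_add h1]; congr 1; ring
        have hp := Real.rpow_pos_of_pos h1 ((β + 1) / 2)
        rw [e, Real.rpow_pow_comm (by norm_num)]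
        field_simp

/-- Gram matrix entries. -/
noncomputable def FF (β : ℝ) (j k : ℕ) : ℝ≥0∞ :=
  ENNReal.ofReal (xx j ^ ((β + 1) / 2) * xx k ^ ((β + 1) / 2) *
      (1 - (1 - xx j) * (1 - xx k)) ^ (-(β + 1)))

/-- The constant. -/
noncomputable def SS (β : ℝ) : ℝ≥0∞ := ∑' i : ℕ, ENNReal.ofReal ((1 / 2 : ℝ) ^ ((β + 1) / 2)) ^ i

lemma SS_ne_top {β : ℝ} (hβ : -1 < β) : SS β ≠ ⊤ := by
  unfold SS
  rw [ENNReal.tsum_geometric]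
  apply ENNReal.inv_ne_top.2
  have : (1 / 2 : ℝ) ^ ((β + 1) / 2) < 1 :=
    Real.rpow_lt_one (by norm_num) (by norm_num) (by linarith)
  have h : ENNReal.ofReal ((1 / 2 : ℝ) ^ ((β + 1) / 2)) < 1 := by
    rw [← ENNReal.ofReal_one]
    exact (ENNReal.ofReal_lt_ofReal_iff one_pos).2 this
  exact (tsub_pos_of_lt h).ne'

lemma FF_le {β : ℝ} (hβ : -1 < β) (j d : ℕ) :
    FF β j (j + d) ≤ ENNReal.ofReal ((1 / 2 : ℝ) ^ ((β + 1) / 2)) ^ d := by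
  unfold FF
  rw [← ENNReal.ofReal_pow (by positivity)]
  exact ENNReal.ofReal_le_ofReal (norm_term hβ j d)

lemma FF_symm (β : ℝ) (j k : ℕ) : FF β j k = FF β k j := by
  unfold FF
  rw [mul_comm (1 - xx j), mul_comm (xx j ^ _)]

lemma FF_row {β : ℝ} (hβ : -1 < β) (j J : ℕ) :
    ∑ k ∈ Finset.range J, FF β j k ≤ 2 * SS β := by
  refine (ENNReal.sum_le_tsum _).trans ?_
  have hsplit : ∑' k, FF β j k = ∑ k ∈ Finset.range j, FF β j k + ∑' i, FF β j (i + j) :=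
    (Summable.sum_add_tsum_nat_add' (f := fun k => FF β j k) (k := j) ENNReal.summable).symm
  rw [hsplit, two_mul]
  refine add_le_add ?_ (ENNReal.tsum_le_tsum fun i => ?_)
  · rw [← Finset.sum_range_reflect]
    refine le_trans (Finset.sum_le_sum fun i hi => ?_)
      (ENNReal.sum_le_tsum (f := fun i => ENNReal.ofReal ((1 / 2 : ℝ) ^ ((β + 1) / 2)) ^ i)
        (Finset.range j))
    have h : i < j := by simpa using hi
    have := FF_le hβ (j - 1 - i) (i + 1)
    rw [show j - 1 - i + (i + 1) = j by omega, FF_symm] at this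
    refine this.trans (pow_le_pow_right_of_le_one' ?_ (by omega))
    rw [← ENNReal.ofReal_one]
    exact ENNReal.ofReal_le_ofReal
      (Real.rpow_le_one (by norm_num) (by norm_num) (by linarith))
  · rw [add_comm i j]
    exact FF_le hβ j i

lemma AA_norm {β : ℝ} (hβ : -1 < β) (J : ℕ) :
    ∑' m, ENNReal.ofReal (Wt β m) * ENNReal.ofReal (AA β J m) ^ 2 ≤ 2 * SS β * J := by
  have e : ∀ m, ENNReal.ofReal (Wt β m) * ENNReal.ofReal (AA β J m) ^ 2 =
      ∑ j ∈ Finset.range J, ∑ k ∈ Finset.range J,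
        ENNReal.ofReal (xx j ^ ((β + 1) / 2) * xx k ^ ((β + 1) / 2)) *
          ENNReal.ofReal (Wt β m * ((1 - xx j) * (1 - xx k)) ^ m) := by
    intro m
    rw [AA_ofReal, pow_two, Finset.sum_mul_sum, Finset.mul_sum]
    refine Finset.sum_congr rfl fun j _ => ?_
    rw [Finset.mul_sum]
    refine Finset.sum_congr rfl fun k _ => ?_
    have h1 := xx_pos j
    have h2 : 0 < 1 - xx j := by linarith [xx_lt j]
    rw [ENNReal.ofReal_mul (by positivity), ENNReal.ofReal_mul (Wt_pos hβ m).le, mul_pow,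
      ENNReal.ofReal_mul (by positivity)]
    ring
  have e2 : ∀ j k, ∑' m, ENNReal.ofReal (xx j ^ ((β + 1) / 2) * xx k ^ ((β + 1) / 2)) *
          ENNReal.ofReal (Wt β m * ((1 - xx j) * (1 - xx k)) ^ m) = FF β j k := by
    intro j k
    have h1 := xx_pos j
    have h2 : 0 < 1 - xx j := by linarith [xx_lt j]
    have h3 := xx_pos k
    have h4 : 0 < 1 - xx k := by linarith [xx_lt k]
    rw [ENNReal.tsum_mul_left, tsum_Wt hβ (by positivity) (by nlinarith), FF,
      ← ENNReal.ofReal_mul (by positivity)]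
  simp only [e]
  rw [Summable.tsum_finsetSum fun _ _ => ENNReal.summable]
  have e3 : ∀ j, ∑' m, ∑ k ∈ Finset.range J,
        ENNReal.ofReal (xx j ^ ((β + 1) / 2) * xx k ^ ((β + 1) / 2)) *
          ENNReal.ofReal (Wt β m * ((1 - xx j) * (1 - xx k)) ^ m) ≤ 2 * SS β := by
    intro j
    rw [Summable.tsum_finsetSum fun _ _ => ENNReal.summable]
    simp only [e2]
    exact FF_row hβ j J
  refine (Finset.sum_le_sum fun j _ => e3 j).trans ?_
  simp [mul_comm]

/-- Entries of the pairing. -/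
noncomputable def GG (β : ℝ) (j k : ℕ) (t : ℝ) : ℝ≥0∞ :=
  ENNReal.ofReal (xx j ^ ((β + 1) / 2) * xx k ^ ((β + 1) / 2) *
      (t * xx j + (1 - t) * xx k) ^ (-(β + 1)))

lemma GG_meas (β : ℝ) (j k : ℕ) : Measurable (GG β j k) := by
  unfold GG; fun_prop

lemma pair_eq (μ : Measure ℝ) {β : ℝ} (hβ : -1 < β) (J : ℕ) :
    ∑' n, ENNReal.ofReal (Wt β n) * ENNReal.ofReal (AA β J n) *
      (∑' m, kap μ β n m * ENNReal.ofReal (AA β J m)) =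
    ∫⁻ t in Ioo (0 : ℝ) 1, ∑ j ∈ Finset.range J, ∑ k ∈ Finset.range J, GG β j k t ∂μ := by
  have e1 : ∀ n, ENNReal.ofReal (Wt β n) * ENNReal.ofReal (AA β J n) *
      (∑' m, kap μ β n m * ENNReal.ofReal (AA β J m)) =
      ∫⁻ t in Ioo (0 : ℝ) 1, ∑' m, ENNReal.ofReal (Wt β n) * ENNReal.ofReal (AA β J n) *
        (Kt β n m t * ENNReal.ofReal (AA β J m)) ∂μ := by
    intro n
    rw [lintegral_tsum fun m => (((Kt_meas β n m).mul_const _).const_mul _).aemeasurable,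
      ← ENNReal.tsum_mul_left]
    refine tsum_congr fun m => ?_
    rw [lintegral_const_mul _ ((Kt_meas β n m).mul_const _), lintegral_mul_const _ (Kt_meas β n m),
      kap]
  simp only [e1]
  rw [← lintegral_tsum fun n => (Measurable.tsum fun m =>
    (((Kt_meas β n m).mul_const _).const_mul _)).aemeasurable]
  refine setLIntegral_congr_fun measurableSet_Ioo fun t ht => ?_
  have e2 : ∀ n m, ENNReal.ofReal (Wt β n) * ENNReal.ofReal (AA β J n) *
        (Kt β n m t * ENNReal.ofReal (AA β J m)) =
      ∑ j ∈ Finset.range J, ∑ k ∈ Finset.range J,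
        ENNReal.ofReal (xx j ^ ((β + 1) / 2) * xx k ^ ((β + 1) / 2)) *
        (ENNReal.ofReal (Wt β n) * ENNReal.ofReal ((1 - xx k) ^ n) *
        (Kt β n m t * ENNReal.ofReal ((1 - xx j) ^ m))) := by
    intro n m
    rw [AA_ofReal, AA_ofReal, Finset.mul_sum, Finset.mul_sum, Finset.mul_sum]
    refine Finset.sum_congr rfl fun j _ => ?_
    rw [Finset.sum_mul]
    refine Finset.sum_congr rfl fun k _ => ?_
    have h1 := xx_pos j
    rw [ENNReal.ofReal_mul (by positivity)]
    ring
  have e3 : ∀ j k, ∑' n, ∑' m, ENNReal.ofReal (xx j ^ ((β + 1) / 2) * xx k ^ ((β + 1) / 2)) *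
        (ENNReal.ofReal (Wt β n) * ENNReal.ofReal ((1 - xx k) ^ n) *
        (Kt β n m t * ENNReal.ofReal ((1 - xx j) ^ m))) = GG β j k t := by
    intro j k
    have h1 := xx_pos j
    have h2 := xx_pos k
    simp only [ENNReal.tsum_mul_left (a := ENNReal.ofReal (xx j ^ ((β + 1) / 2) * _))]
    rw [Kt_pair hβ ht ⟨h1, xx_lt j⟩ ⟨h2, xx_lt k⟩, GG, ← ENNReal.ofReal_mul (by positivity)]
  simp only [e2, Summable.tsum_finsetSum fun _ _ => ENNReal.summable, e3]

lemma GG_low {β t : ℝ} (hβ : -1 < β) (ht : t ∈ Ioo (0 : ℝ) 1) (j k : ℕ)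
    (h1 : t * xx j ≤ 2 * ((1 - t) * xx k)) (h2 : (1 - t) * xx k ≤ 2 * (t * xx j)) :
    ENNReal.ofReal (9 ^ (-((β + 1) / 2)) * hd β t) ≤ GG β j k t := by
  unfold GG hd
  apply ENNReal.ofReal_le_ofReal
  have ht0 := ht.1
  have ht1 : 0 < 1 - t := by linarith [ht.2]
  have hj := xx_pos j
  have hk := xx_pos k
  have hu : 0 < t * xx j := by positivity
  have hv : 0 < (1 - t) * xx k := by positivity
  set u := t * xx j with hu'
  set v := (1 - t) * xx k with hv'
  have h3 : (u + v) ^ 2 ≤ 9 * (u * v) := by nlinarith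
  have h4 : (u + v) ^ (-(β + 1)) = ((u + v) ^ 2) ^ (-((β + 1) / 2)) := by
    rw [← Real.rpow_natCast, ← Real.rpow_mul (by positivity)]
    congr 1; push_cast; ring
  have h5 : (9 * (u * v)) ^ (-((β + 1) / 2)) ≤ (u + v) ^ (-(β + 1)) := by
    rw [h4]
    exact Real.rpow_le_rpow_of_nonpos (by positivity) h3 (by linarith)
  refine le_trans (le_of_eq ?_) (mul_le_mul_of_nonneg_left h5 (by positivity))
  rw [hu', hv', Real.mul_rpow (by norm_num) (by positivity), Real.mul_rpow hu.le hv.le,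
    Real.mul_rpow ht0.le hj.le, Real.mul_rpow ht1.le hk.le, Real.rpow_neg hj.le,
    Real.rpow_neg hk.le]
  have := Real.rpow_pos_of_pos hj ((β + 1) / 2)
  have := Real.rpow_pos_of_pos hk ((β + 1) / 2)
  field_simp

lemma GG_swap (β : ℝ) (j k : ℕ) (t : ℝ) : GG β j k (1 - t) = GG β k j t := by
  unfold GG
  rw [sub_sub_cancel, mul_comm (xx j ^ _), add_comm ((1 - t) * xx j)]

lemma hd_swap (β t : ℝ) : hd β (1 - t) = hd β t := by
  unfold hd
  rw [sub_sub_cancel, mul_comm]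

lemma GG_sum_half {β t : ℝ} (hβ : -1 < β) (ht : t ∈ Ioo (0 : ℝ) 1) (hh : t ≤ 1 / 2) :
    ∃ D : ℕ, ∀ J, 2 * D ≤ J → ENNReal.ofReal (9 ^ (-((β + 1) / 2)) * hd β t) * J ≤
      2 * ∑ j ∈ Finset.range J, ∑ k ∈ Finset.range J, GG β j k t := by
  have ht0 := ht.1
  obtain ⟨D, hD1, hD2⟩ := exists_nat_pow_near (x := (1 - t) / t) (y := 2)
    (by rw [le_div_iff₀ ht0]; linarith) (by norm_num)
  rw [le_div_iff₀ ht0] at hD1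
  rw [div_lt_iff₀ ht0, pow_succ] at hD2
  refine ⟨D, fun J hJ => ?_⟩
  set L := ENNReal.ofReal (9 ^ (-((β + 1) / 2)) * hd β t) with hL
  have hg : ∀ j, L ≤ GG β j (j + D) t := by
    intro j
    have hx := xx_pos j
    have hp : (0 : ℝ) < 2 ^ D := by positivity
    apply GG_low hβ ht
    all_goals
      rw [xx_add, one_div, inv_pow]
    · have : t * xx j ≤ (1 - t) * (xx j * (2 ^ D)⁻¹) := by
        rw [← mul_assoc, ← div_eq_mul_inv, le_div_iff₀ hp]; nlinarith
      have : 0 < t * xx j := by positivity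
      linarith
    · rw [← mul_assoc, ← div_eq_mul_inv, div_le_iff₀ hp]; nlinarith
  have h1 : ((J - D : ℕ) : ℝ≥0∞) * L ≤
      ∑ j ∈ Finset.range J, ∑ k ∈ Finset.range J, GG β j k t := by
    calc ((J - D : ℕ) : ℝ≥0∞) * L = ∑ j ∈ Finset.range (J - D), L := by simp
      _ ≤ ∑ j ∈ Finset.range (J - D), ∑ k ∈ Finset.range J, GG β j k t := by
          refine Finset.sum_le_sum fun j hj => (hg j).trans ?_
          have : j < J - D := by simpa using hj
          exact Finset.single_le_sum (f := fun k => GG β j k t) (fun _ _ => zero_le)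
            (Finset.mem_range.2 (by omega))
      _ ≤ _ := Finset.sum_le_sum_of_subset (Finset.range_mono (by omega))
  refine le_trans ?_ (mul_le_mul_right h1 2)
  rw [← mul_assoc, mul_comm L]
  gcongr
  have : J ≤ 2 * (J - D) := by omega
  exact_mod_cast this

lemma GG_sum {β t : ℝ} (hβ : -1 < β) (ht : t ∈ Ioo (0 : ℝ) 1) :
    ∃ D : ℕ, ∀ J, 2 * D ≤ J → ENNReal.ofReal (9 ^ (-((β + 1) / 2)) * hd β t) * J ≤
      2 * ∑ j ∈ Finset.range J, ∑ k ∈ Finset.range J, GG β j k t := by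
  rcases le_total t (1 / 2) with hh | hh
  · exact GG_sum_half hβ ht hh
  · obtain ⟨D, hD⟩ := GG_sum_half (t := 1 - t) hβ ⟨by linarith [ht.2], by linarith [ht.1]⟩
      (by linarith)
    refine ⟨D, fun J hJ => ?_⟩
    have := hD J hJ
    simp only [GG_swap, hd_swap] at this
    rwa [Finset.sum_comm] at this

lemma mul_le_sq_add (a b : ℝ≥0∞) : a * b ≤ a ^ 2 + b ^ 2 := by
  rcases le_total a b with h | h
  · calc a * b ≤ b * b := by gcongr
      _ ≤ _ := by rw [← pow_two]; exact le_add_self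
  · calc a * b ≤ a * a := by gcongr
      _ ≤ _ := by rw [← pow_two]; exact le_self_add

lemma nec {μ : Measure ℝ} [IsFiniteMeasure μ] {β M : ℝ} (hβ : -1 < β) (h : Bdd μ β M) :
    ∫⁻ t in Ioo (0 : ℝ) 1, ENNReal.ofReal (hd β t) ∂μ ≠ ⊤ := by
  obtain ⟨c, C, hc, hC, hW⟩ := Wt_bounds hβ
  set K := ENNReal.ofReal C * ENNReal.ofReal (M ^ 2) * ENNReal.ofReal c with hK
  have hKt : K ≠ ⊤ := by finiteness
  set B := (1 + K) * (2 * SS β) with hB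
  have hBt : B ≠ ⊤ := by
    have := SS_ne_top hβ
    finiteness
  set G : ℕ → ℝ → ℝ≥0∞ := fun J t =>
    ∑ j ∈ Finset.range J, ∑ k ∈ Finset.range J, GG β j k t with hG
  have mG : ∀ J, Measurable (G J) := fun J =>
    Finset.measurable_sum _ fun j _ => Finset.measurable_sum _ fun k _ => GG_meas β j k
  have hGi : ∀ J, ∫⁻ t in Ioo (0 : ℝ) 1, G J t ∂μ ≤ B * J := by
    intro J
    rw [hG]
    simp only
    rw [← pair_eq μ hβ J]
    set X : ℕ → ℝ≥0∞ := fun n => ∑' m, kap μ β n m * ENNReal.ofReal (AA β J m) with hX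
    calc ∑' n, ENNReal.ofReal (Wt β n) * ENNReal.ofReal (AA β J n) * X n
        ≤ ∑' n, (ENNReal.ofReal (Wt β n) * ENNReal.ofReal (AA β J n) ^ 2 +
          ENNReal.ofReal (Wt β n) * X n ^ 2) := by
          refine ENNReal.tsum_le_tsum fun n => ?_
          rw [mul_assoc, ← mul_add]
          gcongr
          exact mul_le_sq_add _ _
      _ ≤ (1 + K) * ∑' n, ENNReal.ofReal (Wt β n) * ENNReal.ofReal (AA β J n) ^ 2 := by
          rw [ENNReal.tsum_add, add_mul, one_mul]
          gcongr
          exact nec_ext hβ hc hC hW h _ (AA_nonneg β J)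
      _ ≤ (1 + K) * (2 * SS β * J) := by
          gcongr
          exact AA_norm hβ J
      _ = B * J := by rw [hB]; ring
  have hf := lintegral_liminf_le (u := atTop) (μ := μ.restrict (Ioo (0 : ℝ) 1))
    (f := fun (J : ℕ) t => 2 * G J t * (J : ℝ≥0∞)⁻¹) (fun J => ((mG J).const_mul 2).mul_const _)
  have h9 : (0 : ℝ) < 9 ^ (-((β + 1) / 2)) := by positivity
  have hlow : ∫⁻ t in Ioo (0 : ℝ) 1, ENNReal.ofReal (9 ^ (-((β + 1) / 2)) * hd β t) ∂μ ≤
      ∫⁻ t in Ioo (0 : ℝ) 1, liminf (fun J : ℕ => 2 * G J t * (J : ℝ≥0∞)⁻¹) atTop ∂μ := by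
    refine setLIntegral_mono' measurableSet_Ioo fun t ht => ?_
    obtain ⟨D, hD⟩ := GG_sum hβ ht
    refine le_liminf_of_le (by isBoundedDefault) ?_
    filter_upwards [eventually_ge_atTop (2 * D), eventually_ge_atTop 1] with J hJ hJ1
    rw [← div_eq_mul_inv, ENNReal.le_div_iff_mul_le (Or.inl (by
      simp only [ne_eq, Nat.cast_eq_zero]; omega)) (Or.inl (by simp))]
    exact hD J hJ
  have hup : liminf (fun J : ℕ => ∫⁻ t in Ioo (0 : ℝ) 1, 2 * G J t * (J : ℝ≥0∞)⁻¹ ∂μ) atTop ≤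
      2 * B := by
    refine liminf_le_of_frequently_le' (Eventually.frequently ?_)
    filter_upwards [eventually_ge_atTop 1] with J hJ1
    rw [lintegral_mul_const _ ((mG J).const_mul 2), lintegral_const_mul _ (mG J),
      ← div_eq_mul_inv]
    refine ENNReal.div_le_of_le_mul ?_
    rw [mul_assoc]
    gcongr
    exact hGi J
  have htot := (hlow.trans hf).trans hup
  simp only [ENNReal.ofReal_mul h9.le] at htot
  rw [lintegral_const_mul' _ _ ENNReal.ofReal_ne_top] at htot
  intro htop
  rw [htop, ENNReal.mul_top (by simpa using h9)] at htot
  have : 2 * B ≠ ⊤ := by finiteness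
  exact this (top_le_iff.1 htot)

/-- `H_μ^β` is bounded on the Dirichlet-type space `D_{1-β}` (whose norm is given by the
weight `(n+1)^β` on coefficients) iff
`C_β(μ) = ∫_{(0,1)} (1-t)^{-(β+1)/2} t^{-(β+1)/2} dμ(t) < ∞`. -/
theorem Hb_bounded_dirichlet_iff (μ : Measure ℝ) [IsFiniteMeasure μ] (β : ℝ)
    (hβ : -1 < β) :
    (∃ M : ℝ, 0 ≤ M ∧ ∀ a : ℕ → ℂ,
        Summable (fun m : ℕ => ((m : ℝ) + 1) ^ β * ‖a m‖ ^ 2) →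
        ∑' n : ℕ, ENNReal.ofReal (((n : ℝ) + 1) ^ β * ‖Hb μ β a n‖ ^ 2) ≤
          ENNReal.ofReal (M ^ 2) *
            ∑' m : ℕ, ENNReal.ofReal (((m : ℝ) + 1) ^ β * ‖a m‖ ^ 2)) ↔
      (∫⁻ t in Ioo (0 : ℝ) 1,
        ENNReal.ofReal ((1 - t) ^ (-((β + 1) / 2)) * t ^ (-((β + 1) / 2))) ∂μ) ≠ ⊤ := by
  constructor
  · rintro ⟨M, -, h⟩
    exact nec hβ h
  · intro hfin
    obtain ⟨c, C, hc, hC, hW⟩ := Wt_bounds hβ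
    have hw : ∀ n : ℕ, 0 ≤ ((n : ℝ) + 1) ^ β := fun n => by positivity
    set I := ∫⁻ t in Ioo (0 : ℝ) 1,
        ENNReal.ofReal ((1 - t) ^ (-((β + 1) / 2)) * t ^ (-((β + 1) / 2))) ∂μ with hI
    refine ⟨Real.sqrt (c * C) * I.toReal, by positivity, fun a _ => ?_⟩
    simp only [ofReal_mul_norm_sq _ (hw _)]
    calc ∑' n : ℕ, ENNReal.ofReal (((n : ℝ) + 1) ^ β) * ‖Hb μ β a n‖ₑ ^ 2
        ≤ ∑' n : ℕ, ENNReal.ofReal c * (ENNReal.ofReal (Wt β n) *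
            (∑' m, kap μ β n m * ‖a m‖ₑ) ^ 2) := by
          refine ENNReal.tsum_le_tsum fun n => ?_
          rw [← mul_assoc, ← ENNReal.ofReal_mul hc.le]
          exact mul_le_mul' (ENNReal.ofReal_le_ofReal (hW n).2)
            (pow_le_pow_left₀ zero_le (enorm_Hb_le hβ a n) 2)
      _ ≤ ENNReal.ofReal c * (I ^ 2 * ∑' m, ENNReal.ofReal (Wt β m) * ‖a m‖ₑ ^ 2) := by
          rw [ENNReal.tsum_mul_left]
          gcongr
          exact suff_core μ hβ fun m => ‖a m‖ₑ
      _ ≤ ENNReal.ofReal c * (I ^ 2 * ∑' m : ℕ, ENNReal.ofReal C *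
            (ENNReal.ofReal (((m : ℝ) + 1) ^ β) * ‖a m‖ₑ ^ 2)) := by
          refine mul_le_mul_right (mul_le_mul_right (ENNReal.tsum_le_tsum fun m => ?_) _) _
          rw [← mul_assoc, ← ENNReal.ofReal_mul hC.le]
          gcongr
          exact (hW m).1
      _ = _ := by
          rw [ENNReal.tsum_mul_left, mul_pow, Real.sq_sqrt (by positivity),
            ENNReal.ofReal_mul (by positivity), ENNReal.ofReal_mul hc.le,
            ENNReal.ofReal_pow (by positivity), ENNReal.ofReal_toReal hfin]
          ring
end

section
/- Let 1 ≤ p < ∞, let α, β > -1 with β - α > -1, let t ∈ (0,1) and n ∈ ℕ₀, and let a = {a_m}_{m=0}^∞ be a sequence of complex numbers. Set E_n(t) = ∑_{m=0}^∞ k_{α,β}(m,n) t^m (1-t)^n |a_m|. Then E_n(t)^p ≤ (1-t)^{-(β+1)(p-1)} · (n+β-α+1)_α^{p-1} · ∑_{m=0}^∞ k_{α,β}(m,n) t^m (1-t)^n |a_m|^p (m+1)_α^{1-p}. -/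
open ENNReal

theorem choose_gamma (c : ℝ) (hc : 0 < c) (m : ℕ) :
    Ring.choose (c + m - 1) m = Real.Gamma (c + m) / (Real.Gamma ((m:ℝ) + 1) * Real.Gamma c) := by
  have hG : 0 < Real.Gamma c := Real.Gamma_pos_of_pos hc
  have h1 : ∀ m : ℕ, Real.Gamma (c + m) = (ascPochhammer ℝ m).eval c * Real.Gamma c := by
    intro m
    induction m with
    | zero => simp
    | succ k ih =>
      rw [ascPochhammer_succ_eval]
      push_cast
      rw [← add_assoc, Real.Gamma_add_one (by positivity), ih]; ring
  have h2 := Ring.factorial_nsmul_multichoose_eq_ascPochhammer c m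
  rw [Polynomial.ascPochhammer_smeval_eq_eval, nsmul_eq_mul, Ring.multichoose_eq] at h2
  rw [Real.Gamma_nat_eq_factorial, h1, ← h2]
  have : (m.factorial : ℝ) ≠ 0 := by positivity
  field_simp

theorem hasSum_gamma (c t : ℝ) (hc : 0 < c) (ht : t ∈ Set.Ioo (0 : ℝ) 1) :
    HasSum (fun m : ℕ => Real.Gamma (c + m) / (Real.Gamma ((m:ℝ) + 1) * Real.Gamma c) * t ^ m)
      ((1 - t) ^ (-c)) := by
  have h := (Real.one_div_one_sub_rpow_hasFPowerSeriesOnBall_zero c).hasSum (y := t)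
    (by simp [Real.enorm_eq_ofReal ht.1.le, ht.2])
  rw [zero_add] at h
  simp only [← choose_gamma c hc]
  rw [Real.rpow_neg (by linarith [ht.2]), ← one_div]
  simpa [mul_comm] using! h

theorem tsum_jensen (p : ℝ) (hp : 1 ≤ p) (w f : ℕ → ℝ≥0∞) :
    (∑' m, w m * f m) ^ p ≤ (∑' m, w m) ^ (p - 1) * ∑' m, w m * f m ^ p := by
  have hp0 : 0 < p := by linarith
  have h : ∑' m, w m * f m ≤ (∑' m, w m) ^ (1 - p⁻¹) * (∑' m, w m * f m ^ p) ^ p⁻¹ := by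
    rw [ENNReal.tsum_eq_iSup_sum]
    refine iSup_le fun s => (ENNReal.inner_le_weight_mul_Lp_of_nonneg s hp w f).trans ?_
    have : 0 ≤ 1 - p⁻¹ := by linarith [inv_le_one_of_one_le₀ hp]
    gcongr <;> exact ENNReal.sum_le_tsum s
  refine (ENNReal.rpow_le_rpow h hp0.le).trans_eq ?_
  rw [ENNReal.mul_rpow_of_nonneg _ _ hp0.le, ← ENNReal.rpow_mul, ← ENNReal.rpow_mul,
    inv_mul_cancel₀ hp0.ne', ENNReal.rpow_one, sub_mul, inv_mul_cancel₀ hp0.ne', one_mul]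

/-- With `E_n(t) = ∑_m k_{α,β}(m,n) t^m (1-t)^n |a_m|` (a sum in `[0,∞]`), one has
`E_n(t)^p ≤ (1-t)^{-(β+1)(p-1)} (n+β-α+1)_α^{p-1}
  ∑_m k_{α,β}(m,n) t^m (1-t)^n |a_m|^p (m+1)_α^{1-p}`. -/
theorem En_pow_le (p α β : ℝ) (hp : 1 ≤ p) (hα : -1 < α) (hβ : -1 < β)
    (hβα : -1 < β - α) (t : ℝ) (ht : t ∈ Set.Ioo (0 : ℝ) 1) (n : ℕ) (a : ℕ → ℂ) :
    (∑' m : ℕ, ENNReal.ofReal (kker α β m n * t ^ m * (1 - t) ^ n * ‖a m‖)) ^ p ≤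
      ENNReal.ofReal ((1 - t) ^ (-(β + 1) * (p - 1)) *
          (poch ((n : ℝ) + β - α) α) ^ (p - 1)) *
        ∑' m : ℕ, ENNReal.ofReal
          (kker α β m n * t ^ m * (1 - t) ^ n * ‖a m‖ ^ p * (poch (m : ℝ) α) ^ (1 - p)) := by
  obtain ⟨ht0, ht1⟩ := ht
  have hs : 0 < 1 - t := by linarith
  have hn : (0:ℝ) ≤ n := n.cast_nonneg
  have hm : ∀ m : ℕ, (0:ℝ) ≤ m := fun m => m.cast_nonneg
  have hP : ∀ m : ℕ, 0 < poch (m : ℝ) α := fun m =>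
    div_pos (Real.Gamma_pos_of_pos (by linarith [hm m])) (Real.Gamma_pos_of_pos (by linarith [hm m]))
  have hQ : 0 < poch ((n : ℝ) + β - α) α :=
    div_pos (Real.Gamma_pos_of_pos (by linarith)) (Real.Gamma_pos_of_pos (by linarith))
  have hK : ∀ m : ℕ, 0 < kker α β m n := fun m =>
    div_pos (Real.Gamma_pos_of_pos (by linarith [hm m])) (mul_pos
      (Real.Gamma_pos_of_pos (by linarith [hm m])) (Real.Gamma_pos_of_pos (by linarith)))
  have hW : ∀ m : ℕ, 0 < kker α β m n * t ^ m * (1 - t) ^ n * poch (m : ℝ) α := fun m => by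
    have := hP m
    have := hK m
    positivity
  have hsum : HasSum (fun m : ℕ => kker α β m n * t ^ m * (1 - t) ^ n * poch (m : ℝ) α)
      ((1 - t) ^ (-(β + 1)) * poch ((n : ℝ) + β - α) α) := by
    have h := (hasSum_gamma (n + β + 1) t (by linarith) ⟨ht0, ht1⟩).mul_left
      ((1 - t) ^ n * poch ((n : ℝ) + β - α) α)
    convert! h using 1
    · funext m
      have h1 : Real.Gamma ((m:ℝ) + α + 1) ≠ 0 := (Real.Gamma_pos_of_pos (by linarith [hm m])).ne'
      have h2 : Real.Gamma ((n:ℝ) + β + 1) ≠ 0 := (Real.Gamma_pos_of_pos (by linarith)).ne'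
      have e1 : (n : ℝ) + β - α + α + 1 = n + β + 1 := by ring
      have e2 : (n : ℝ) + m + β + 1 = n + β + 1 + m := by ring
      unfold kker poch
      rw [e1, e2]
      field_simp
    · rw [← Real.rpow_natCast, mul_right_comm, ← Real.rpow_add hs]
      congr 2
      ring
  have hts : ∑' m : ℕ, ENNReal.ofReal (kker α β m n * t ^ m * (1 - t) ^ n * poch (m : ℝ) α) =
      ENNReal.ofReal ((1 - t) ^ (-(β + 1)) * poch ((n : ℝ) + β - α) α) := by
    rw [← ENNReal.ofReal_tsum_of_nonneg (fun m => (hW m).le) hsum.summable, hsum.tsum_eq]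
  have key := tsum_jensen p hp
    (fun m : ℕ => ENNReal.ofReal (kker α β m n * t ^ m * (1 - t) ^ n * poch (m : ℝ) α))
    (fun m : ℕ => ENNReal.ofReal (‖a m‖ / poch (m : ℝ) α))
  rw [hts, ENNReal.ofReal_rpow_of_nonneg (by positivity) (by linarith),
    Real.mul_rpow (by positivity) hQ.le, ← Real.rpow_mul hs.le] at key
  convert key using 4 with m m
  · rw [← ENNReal.ofReal_mul (hW m).le]
    have := (hP m).ne'
    congr 1
    field_simp
  · rw [ENNReal.ofReal_rpow_of_nonneg (div_nonneg (norm_nonneg _) (hP m).le) (by linarith),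
      ← ENNReal.ofReal_mul (hW m).le, Real.div_rpow (norm_nonneg _) (hP m).le,
      Real.rpow_sub (hP m), Real.rpow_one]
    congr 1
    ring
end

section
/- Let 1 ≤ p < ∞, let α, β > -1 with β - α > -1, let t ∈ (0,1), and let a = {a_m}_{m=0}^∞ be a sequence of complex numbers. Set E_n(t) = ∑_{m=0}^∞ k_{α,β}(m,n) t^m (1-t)^n |a_m| for n ∈ ℕ₀. Then ∑_{n=0}^∞ w₂(n) E_n(t)^p ≤ (1-t)^{-(β+1)(p-1)} · t^{-β-1} · ∑_{m=0}^∞ w₁(m) |a_m|^p. -/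
open ENNReal

theorem aux_gamma (c : ℝ) (hc : 0 < c) (n : ℕ) :
    Ring.choose (c + n - 1) n = Real.Gamma (c + n) / (n.factorial * Real.Gamma c) := by
  have h1 : Real.Gamma (c + n) = (ascPochhammer ℝ n).eval c * Real.Gamma c := by
    induction n with
    | zero => simp
    | succ k ih =>
      have : c + ((k + 1 : ℕ) : ℝ) = (c + k) + 1 := by push_cast; ring
      rw [this, Real.Gamma_add_one (by positivity), ih, ascPochhammer_succ_eval]
      ring
  have h2 := Ring.factorial_nsmul_multichoose_eq_ascPochhammer c n
  rw [Polynomial.ascPochhammer_smeval_eq_eval, nsmul_eq_mul] at h2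
  rw [← Ring.multichoose_eq, h1, ← h2]
  have := (Real.Gamma_pos_of_pos hc).ne'
  have : (n.factorial : ℝ) ≠ 0 := by positivity
  field_simp

theorem aux_binom (c : ℝ) (hc : 0 < c) (x : ℝ) (hx : x ∈ Set.Ioo (0 : ℝ) 1) :
    ∑' n : ℕ, ENNReal.ofReal (Real.Gamma (c + n) / (n.factorial * Real.Gamma c) * x ^ n) =
      ENNReal.ofReal ((1 - x) ^ (-c)) := by
  have h := (Real.one_div_one_sub_rpow_hasFPowerSeriesOnBall_zero c).hasSum (y := x)
    (by simp [abs_of_pos hx.1, hx.2, ← ofReal_norm])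
  have h' : HasSum (fun n : ℕ => Real.Gamma (c + n) / (n.factorial * Real.Gamma c) * x ^ n)
      ((1 - x) ^ (-c)) := by
    have e : (1 - x) ^ (-c) = 1 / (1 - (0 + x)) ^ c := by
      rw [zero_add, Real.rpow_neg (by linarith [hx.2]), one_div]
    rw [e]
    refine (congrArg (fun g => HasSum g _) (funext fun n => ?_)).mpr h
    rw [← aux_gamma c hc n]
    simp [FormalMultilinearSeries.ofScalars]
  rw [← h'.tsum_eq, ENNReal.ofReal_tsum_of_nonneg _ h'.summable]
  intro n
  have := Real.Gamma_pos_of_pos hc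
  have : 0 < Real.Gamma (c + n) := Real.Gamma_pos_of_pos (by positivity)
  have := hx.1
  positivity

theorem aux_jensen (p : ℝ) (hp : 1 ≤ p) (w f : ℕ → ℝ≥0∞) :
    (∑' i, w i * f i) ^ p ≤ (∑' i, w i) ^ (p - 1) * ∑' i, w i * f i ^ p := by
  have hp0 : 0 < p := by linarith
  have h : ∑' i, w i * f i ≤ (∑' i, w i) ^ (1 - p⁻¹) * (∑' i, w i * f i ^ p) ^ p⁻¹ := by
    rw [ENNReal.tsum_eq_iSup_sum]
    refine iSup_le fun s => ?_
    refine (ENNReal.inner_le_weight_mul_Lp_of_nonneg s hp w f).trans ?_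
    have : 0 ≤ 1 - p⁻¹ := by
      have := inv_le_one_of_one_le₀ hp
      linarith
    gcongr <;> exact ENNReal.sum_le_tsum s
  calc _ ≤ _ := ENNReal.rpow_le_rpow h hp0.le
    _ = _ := by
      rw [ENNReal.mul_rpow_of_nonneg _ _ hp0.le, ← ENNReal.rpow_mul, ← ENNReal.rpow_mul,
        inv_mul_cancel₀ hp0.ne', ENNReal.rpow_one]
      congr 2
      field_simp


open ENNReal

/-- With `E_n(t) = ∑_m k_{α,β}(m,n) t^m (1-t)^n |a_m|` (sums in `[0,∞]`), one has
`∑_n w₂(n) E_n(t)^p ≤ (1-t)^{-(β+1)(p-1)} t^{-β-1} ∑_m w₁(m) |a_m|^p`. -/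
theorem tsum_w2_En_pow_le (p α β : ℝ) (hp : 1 ≤ p) (hα : -1 < α) (hβ : -1 < β)
    (hβα : -1 < β - α) (t : ℝ) (ht : t ∈ Set.Ioo (0 : ℝ) 1) (a : ℕ → ℂ) :
    ∑' n : ℕ, ENNReal.ofReal (w2 α β p n) *
        (∑' m : ℕ, ENNReal.ofReal (kker α β m n * t ^ m * (1 - t) ^ n * ‖a m‖)) ^ p ≤
      ENNReal.ofReal ((1 - t) ^ (-(β + 1) * (p - 1)) * t ^ (-β - 1)) *
        ∑' m : ℕ, ENNReal.ofReal (w1 α β p m * ‖a m‖ ^ p) := by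

  obtain ⟨ht0, ht1⟩ := ht
  have ht1' : 0 < 1 - t := by linarith
  have hp0 : 0 < p := by linarith
  have gm : ∀ m : ℕ, 0 < Real.Gamma ((m : ℝ) + α + 1) := fun m =>
    Real.Gamma_pos_of_pos (by have : (0 : ℝ) ≤ m := by positivity
                              linarith)
  have gb : ∀ m : ℕ, 0 < Real.Gamma ((m : ℝ) + β + 1) := fun m =>
    Real.Gamma_pos_of_pos (by have : (0 : ℝ) ≤ m := by positivity
                              linarith)
  have gd : ∀ m : ℕ, 0 < Real.Gamma ((m : ℝ) + β - α + 1) := fun m =>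
    Real.Gamma_pos_of_pos (by have : (0 : ℝ) ≤ m := by positivity
                              linarith)
  have gnm : ∀ n m : ℕ, 0 < Real.Gamma ((n : ℝ) + β + 1 + m) := fun n m =>
    Real.Gamma_pos_of_pos (by have : (0 : ℝ) ≤ m := by positivity
                              have : (0 : ℝ) ≤ n := by positivity
                              linarith)
  have pa : ∀ m : ℕ, 0 < poch m α := fun m => div_pos (gm m)
    (Real.Gamma_pos_of_pos (by positivity))
  have pb : ∀ m : ℕ, 0 < poch m β := fun m => div_pos (gb m)
    (Real.Gamma_pos_of_pos (by positivity))
  have pd : ∀ m : ℕ, 0 < poch ((m : ℝ) + β - α) α := fun m => by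
    unfold poch
    have e : (m : ℝ) + β - α + α + 1 = m + β + 1 := by ring
    rw [e]
    exact div_pos (gb m) (gd m)
  -- the normalized kernel and the normalized sequence
  set q : ℕ → ℕ → ℝ := fun n m =>
    Real.Gamma ((n : ℝ) + β + 1 + m) / (m.factorial * Real.Gamma ((n : ℝ) + β + 1)) * t ^ m *
      (1 - t) ^ n with hq
  set b : ℕ → ℝ := fun m => ‖a m‖ / poch m α with hb
  have q0 : ∀ n m, 0 < q n m := fun n m => by
    have := gnm n m
    have := gb n
    simp only [hq]
    positivity
  have b0 : ∀ m, 0 ≤ b m := fun m => div_nonneg (norm_nonneg _) (pa m).le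
  have key : ∀ n m : ℕ, (poch ((n : ℝ) + β - α) α)⁻¹ *
      (kker α β m n * t ^ m * (1 - t) ^ n * ‖a m‖) = q n m * b m := fun n m => by
    simp only [hq, hb, poch, kker]
    have e1 : (n : ℝ) + β - α + α + 1 = n + β + 1 := by ring
    have e2 : (n : ℝ) + m + β + 1 = n + β + 1 + m := by ring
    rw [e1, e2, Real.Gamma_nat_eq_factorial]
    have := (gm m).ne'
    have := (gb n).ne'
    have := (gd n).ne'
    have : (m.factorial : ℝ) ≠ 0 := by positivity
    field_simp
  have sumq : ∀ n : ℕ, ∑' m, ENNReal.ofReal (q n m) = ENNReal.ofReal ((1 - t) ^ (-(β + 1))) := by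
    intro n
    have hc : 0 < (n : ℝ) + β + 1 := by
      have : (0 : ℝ) ≤ n := by positivity
      linarith
    have h := aux_binom _ hc t ⟨ht0, ht1⟩
    simp only [hq]
    simp_rw [ENNReal.ofReal_mul' (pow_nonneg ht1'.le n)]
    rw [ENNReal.tsum_mul_right, h, ← ENNReal.ofReal_mul (by positivity), ← Real.rpow_natCast,
      ← Real.rpow_add ht1']
    congr 2
    ring
  have sumq' : ∀ m : ℕ, ∑' n : ℕ, ENNReal.ofReal (poch n β) * ENNReal.ofReal (q n m) =
      ENNReal.ofReal (poch m β) * ENNReal.ofReal (t ^ (-β - 1)) := by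
    intro m
    have hc : 0 < (m : ℝ) + β + 1 := by
      have : (0 : ℝ) ≤ m := by positivity
      linarith
    have h := aux_binom _ hc (1 - t) ⟨ht1', by linarith⟩
    have e : ∀ n : ℕ, ENNReal.ofReal (poch n β) * ENNReal.ofReal (q n m) =
        ENNReal.ofReal (poch m β * t ^ m) * ENNReal.ofReal
          (Real.Gamma ((m : ℝ) + β + 1 + n) / (n.factorial * Real.Gamma ((m : ℝ) + β + 1)) *
            (1 - t) ^ n) := by
      intro n
      rw [← ENNReal.ofReal_mul (pb n).le, ← ENNReal.ofReal_mul
        (mul_nonneg (pb m).le (by positivity))]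
      congr 1
      simp only [hq, poch]
      have e2 : (n : ℝ) + β + 1 + m = m + β + 1 + n := by ring
      rw [e2, Real.Gamma_nat_eq_factorial, Real.Gamma_nat_eq_factorial]
      have := (gb m).ne'
      have := (gb n).ne'
      have : (m.factorial : ℝ) ≠ 0 := by positivity
      have : (n.factorial : ℝ) ≠ 0 := by positivity
      field_simp
    simp_rw [e]
    rw [ENNReal.tsum_mul_left, h, ENNReal.ofReal_mul (pb m).le, mul_assoc,
      ← ENNReal.ofReal_mul (by positivity), _root_.sub_sub_cancel, ← Real.rpow_natCast,
      ← Real.rpow_add ht0]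
    congr 3
    ring
  have step : ∀ n : ℕ, ENNReal.ofReal (w2 α β p n) *
        (∑' m : ℕ, ENNReal.ofReal (kker α β m n * t ^ m * (1 - t) ^ n * ‖a m‖)) ^ p ≤
      ENNReal.ofReal ((1 - t) ^ (-(β + 1) * (p - 1))) *
        ∑' m : ℕ, ENNReal.ofReal (poch n β) * ENNReal.ofReal (q n m) *
          ENNReal.ofReal (b m) ^ p := by
    intro n
    have e1 : ENNReal.ofReal (w2 α β p n) = ENNReal.ofReal (poch n β) *
        ENNReal.ofReal (poch ((n : ℝ) + β - α) α)⁻¹ ^ p := by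
      rw [ENNReal.ofReal_rpow_of_nonneg (inv_nonneg.2 (pd n).le) hp0.le,
        ← ENNReal.ofReal_mul (pb n).le, Real.inv_rpow (pd n).le, ← Real.rpow_neg (pd n).le,
        mul_comm]
      rfl
    rw [e1, mul_assoc, ← ENNReal.mul_rpow_of_nonneg _ _ hp0.le, ← ENNReal.tsum_mul_left]
    simp_rw [← ENNReal.ofReal_mul (inv_nonneg.2 (pd n).le), key,
      fun m => ENNReal.ofReal_mul (q := b m) (q0 n m).le]
    refine (mul_le_mul_right (aux_jensen p hp _ _) _).trans ?_
    rw [sumq, ENNReal.ofReal_rpow_of_nonneg (by positivity) (by linarith),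
      ← Real.rpow_mul ht1'.le, mul_left_comm, ← ENNReal.tsum_mul_left]
    simp_rw [mul_assoc]
    exact le_rfl
  refine (ENNReal.tsum_le_tsum step).trans ?_
  rw [ENNReal.tsum_mul_left, ENNReal.tsum_comm, ENNReal.ofReal_mul (by positivity), mul_assoc]
  refine mul_le_mul_right ?_ _
  simp_rw [ENNReal.tsum_mul_right, sumq']
  rw [← ENNReal.tsum_mul_left]
  refine ENNReal.tsum_le_tsum fun m => le_of_eq ?_
  have e2 : w1 α β p m * ‖a m‖ ^ p = poch m β * b m ^ p := by
    simp only [w1, hb]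
    rw [Real.div_rpow (norm_nonneg _) (pa m).le, Real.rpow_neg (pa m).le]
    ring
  rw [e2, ENNReal.ofReal_mul (pb m).le, ENNReal.ofReal_rpow_of_nonneg (b0 m) hp0.le]
  ring
end
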